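/- arXiv:1809.03059 — 3 statements merged into one kernel-verified Lean document; each statement's English description precedes it below -/
import Mathlib

section
/- Let Z ⊆ P^{a_1} × ... × P^{a_n} be a complete intersection defined by multigraded forms f_1,...,f_c whose degrees sum to (a_1+1, ..., a_n+1). Then the multi-Veronese transform T_b of its coordinate ring is a Gorenstein graded ring with a-invariant 0 for every b ∈ ℕ_+^n; i.e., the correspondence scroll C(Z;b) is arithmetically Gorenstein and numerically Calabi–Yau. -/
/-!
STATEMENT 8: if `Z ⊆ ℙ^{a₁} × ⋯ × ℙ^{aₙ}` is a complete intersection of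
multigraded forms `f₁,…,f_c` with `∑ deg fⱼ = (a₁+1,…,aₙ+1)`, then for every `b`
the ring `T_b(A/(f))` is Gorenstein with `a`-invariant `0` (so `C(Z;b)` is
arithmetically Gorenstein and numerically Calabi–Yau).

"Gorenstein graded with `a`-invariant `w`" is encoded by the standard
characterization: there is a homogeneous regular sequence `θ₁,…,θ_c` (of degrees
`s₁,…,s_c`) such that the quotient is a finite-dimensional algebra whose socle is
one-dimensional, concentrated in degree `∑ sⱼ + w`.
-/

open MvPolynomial

set_option synthInstance.maxHeartbeats 1000000
set_option maxHeartbeats 2000000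

noncomputable section

def coxWeight (n : ℕ) (a : Fin n → ℕ) : ((i : Fin n) × Fin (a i + 1)) → (Fin n → ℕ) :=
  fun p => Pi.single p.1 1

def quotComponent {k : Type} [Field k] {n : ℕ} {a : Fin n → ℕ}
    (I : Ideal (MvPolynomial ((i : Fin n) × Fin (a i + 1)) k)) (d : Fin n → ℕ) :
    Submodule k (MvPolynomial ((i : Fin n) × Fin (a i + 1)) k ⧸ I) :=
  (weightedHomogeneousSubmodule k (coxWeight n a) d).map
    (Ideal.Quotient.mkₐ k I).toLinearMap

/-- The degree-`s` piece of the standard graded ring `T_b(A/I)`. -/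
def TbPiece {k : Type} [Field k] {n : ℕ} {a : Fin n → ℕ}
    (I : Ideal (MvPolynomial ((i : Fin n) × Fin (a i + 1)) k)) (b : Fin n → ℕ)
    (s : ℕ) :
    Submodule k (MvPolynomial ((i : Fin n) × Fin (a i + 1)) k ⧸ I) :=
  ⨆ t ∈ Finset.Nat.antidiagonalTuple n s, quotComponent I (fun i => b i * t i)

/-- The subalgebra `T_b(A/I) ⊆ A/I`. -/
def Tb {k : Type} [Field k] {n : ℕ} {a : Fin n → ℕ}
    (I : Ideal (MvPolynomial ((i : Fin n) × Fin (a i + 1)) k)) (b : Fin n → ℕ) :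
    Subalgebra k (MvPolynomial ((i : Fin n) × Fin (a i + 1)) k ⧸ I) :=
  Algebra.adjoin k
    { x | ∃ m : ((i : Fin n) × Fin (a i + 1)) →₀ ℕ,
        (∀ i, b i ∣ Finsupp.weight (coxWeight n a) m i) ∧
        x = Ideal.Quotient.mk I (monomial m 1) }

/-- The standard graded `k`-algebra `T_b(A/I)` is Gorenstein with `a`-invariant
`w`: it admits a homogeneous regular sequence `θ` (a homogeneous system of
parameters) with finite-dimensional quotient whose socle is one-dimensional,
concentrated in degree `∑ deg θⱼ + w`. -/
def TbGorensteinWithA {k : Type} [Field k] {n : ℕ} {a : Fin n → ℕ}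
    (I : Ideal (MvPolynomial ((i : Fin n) × Fin (a i + 1)) k)) (b : Fin n → ℕ)
    (w : ℤ) : Prop :=
  ∃ (c : ℕ) (θ : Fin c → (Tb I b)) (sd : Fin c → ℕ),
    (∀ j, (θ j : MvPolynomial ((i : Fin n) × Fin (a i + 1)) k ⧸ I) ∈
        TbPiece I b (sd j)) ∧
    RingTheory.Sequence.IsRegular (Tb I b) (List.ofFn θ) ∧
    FiniteDimensional k ((Tb I b) ⧸ Ideal.span (Set.range θ)) ∧
    ∃ (s : ℕ) (x₀ : (Tb I b) ⧸ Ideal.span (Set.range θ)),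
      (s : ℤ) = (∑ j, (sd j : ℤ)) + w ∧
      x₀ ≠ 0 ∧
      (∃ y : (Tb I b), (y : MvPolynomial ((i : Fin n) × Fin (a i + 1)) k ⧸ I) ∈
          TbPiece I b s ∧ x₀ = Ideal.Quotient.mk (Ideal.span (Set.range θ)) y) ∧
      (∀ x : (Tb I b) ⧸ Ideal.span (Set.range θ),
        (∀ g : (Tb I b),
          (g : MvPolynomial ((i : Fin n) × Fin (a i + 1)) k ⧸ I) ∈ TbPiece I b 1 →
            Ideal.Quotient.mk (Ideal.span (Set.range θ)) g * x = 0) →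
        ∃ cst : k, x = cst • x₀)

namespace CYaux

set_option linter.unusedSectionVars false

/-! ### Regular elements and prime avoidance -/

/-- `g` is a nonzerodivisor modulo `J`. -/
def RegMod {R : Type} [CommRing R] (J : Ideal R) (g : R) : Prop := ∀ a, g * a ∈ J → a ∈ J

theorem mem_sup_sing {R : Type} [CommRing R] {J : Ideal R} {u x : R} :
    x ∈ J ⊔ Ideal.span {u} ↔ ∃ c, x - u * c ∈ J := by
  rw [sup_comm, Ideal.mem_span_singleton_sup]
  constructor
  · rintro ⟨a, b, hb, rfl⟩
    exact ⟨a, by convert hb using 1; ring⟩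
  · rintro ⟨c, hc⟩
    exact ⟨c, _, hc, by ring⟩

theorem exists_primes {R : Type} [CommRing R] [IsNoetherianRing R] (J : Ideal R) :
    ∃ s : Finset (Ideal R), (∀ p ∈ s, p.IsPrime ∧ ∃ a, a ∉ J ∧ ∀ r, r ∈ p ↔ r * a ∈ J) ∧
      ∀ r, (∀ p ∈ s, r ∉ p) → RegMod J r := by
  classical
  refine ⟨(associatedPrimes.finite R (R ⧸ J)).toFinset, ?_, ?_⟩
  · intro p hp
    rw [Set.Finite.mem_toFinset, AssociatedPrimes.mem_iff, isAssociatedPrime_iff] at hp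
    obtain ⟨hp, x, rfl⟩ := hp
    obtain ⟨a, rfl⟩ := Ideal.Quotient.mk_surjective x
    have key : ∀ r, r ∈ (⊥ : Submodule R (R ⧸ J)).colon {Ideal.Quotient.mk J a} ↔ r * a ∈ J := by
      intro r
      rw [Submodule.mem_colon_singleton, Submodule.mem_bot, ← Ideal.Quotient.eq_zero_iff_mem,
        map_mul]
      rfl
    refine ⟨hp, a, ?_, key⟩
    intro ha
    apply hp.ne_top
    rw [Ideal.eq_top_iff_one, key]
    simpa using ha
  · intro r hr a ha
    by_contra hna
    have : r ∈ ⋃ p ∈ associatedPrimes R (R ⧸ J), (p : Set R) := by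
      rw [biUnion_associatedPrimes_eq_zero_divisors]
      refine ⟨Ideal.Quotient.mk J a, ?_, ?_⟩
      · rwa [Ne, Ideal.Quotient.eq_zero_iff_mem]
      · have : Ideal.Quotient.mk J (r * a) = 0 := Ideal.Quotient.eq_zero_iff_mem.2 ha
        rw [map_mul] at this
        exact this
    simp only [Set.mem_iUnion] at this
    obtain ⟨p, hp, hrp⟩ := this
    exact hr p (by simpa using hp) hrp

theorem avoid {R : Type} [CommRing R] (V : ℕ → Set R) (h0 : ∃ x, x ∈ V 1) (h1 : 1 ∈ V 0)
    (hadd : ∀ d x y, x ∈ V d → y ∈ V d → x + y ∈ V d)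
    (hmul : ∀ d e x y, x ∈ V d → y ∈ V e → x * y ∈ V (d + e)) (s : Finset (Ideal R)) :
    (∀ p ∈ s, p.IsPrime ∧ ∃ d > 0, ∃ x ∈ V d, x ∉ p) →
      ∃ d > 0, ∃ x ∈ V d, ∀ p ∈ s, x ∉ p := by
  classical
  have hpow : ∀ d x n, x ∈ V d → x ^ n ∈ V (n * d) := by
    intro d x n hx
    induction n with
    | zero => simpa using h1
    | succ n ih => rw [pow_succ, Nat.succ_mul]; exact hmul _ _ _ _ ih hx
  induction s using Finset.strongInduction with
  | H s ih =>
  intro hs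
  rcases s.eq_empty_or_nonempty with rfl | ⟨p, hp⟩
  · obtain ⟨x, hx⟩ := h0
    exact ⟨1, one_pos, x, hx, by simp⟩
  by_contra hcon
  push Not at hcon
  have A : ∀ q ∈ s, ∃ d > 0, ∃ x ∈ V d, (∀ p ∈ s, p ≠ q → x ∉ p) ∧ x ∈ q := by
    intro q hq
    obtain ⟨d, hd, x, hx, hx'⟩ := ih (s.erase q) (Finset.erase_ssubset hq)
      (fun p hp => hs p (Finset.mem_of_mem_erase hp))
    refine ⟨d, hd, x, hx, fun p hp hpq => hx' p (Finset.mem_erase.2 ⟨hpq, hp⟩), ?_⟩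
    obtain ⟨q', hq', hxq'⟩ := hcon d hd x hx
    by_cases h : q' = q
    · exact h ▸ hxq'
    · exact absurd hxq' (hx' q' (Finset.mem_erase.2 ⟨h, hq'⟩))
  choose! D hD x hx hx1 hx2 using A
  rcases (s.erase p).eq_empty_or_nonempty with hT | hT
  · obtain ⟨hpp, d, hd, y, hy, hyp⟩ := hs p hp
    obtain ⟨q, hq, hyq⟩ := hcon d hd y hy
    by_cases h : q = p
    · exact hyp (h ▸ hyq)
    · have : q ∈ s.erase p := Finset.mem_erase.2 ⟨h, hq⟩
      simp [hT] at this
  have hprod : ∀ T : Finset (Ideal R), T ⊆ s → ∏ q ∈ T, x q ∈ V (∑ q ∈ T, D q) := by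
    intro T
    induction T using Finset.induction_on with
    | empty => intro _; simpa using h1
    | insert a T ha ih =>
      intro hT
      rw [Finset.prod_insert ha, Finset.sum_insert ha]
      exact hmul _ _ _ _ (hx a (hT (Finset.mem_insert_self _ _)))
        (ih (fun t ht => hT (Finset.mem_insert_of_mem ht)))
  have hy := hprod (s.erase p) (Finset.erase_subset _ _)
  set y := ∏ q ∈ s.erase p, x q with hydef
  set E := ∑ q ∈ s.erase p, D q with hEdef
  have hE : 0 < E := by
    rw [hEdef]
    exact Finset.sum_pos (fun q hq => hD q (Finset.mem_of_mem_erase hq)) hT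
  have hyp : y ∉ p := by
    have := (hs p hp).1
    rw [hydef, Ideal.IsPrime.prod_mem_iff]
    rintro ⟨q, hq, hqp⟩
    exact hx1 q (Finset.mem_of_mem_erase hq) p hp (Finset.ne_of_mem_erase hq).symm hqp
  obtain ⟨q, hq, hzq⟩ := hcon (E * D p) (Nat.mul_pos hE (hD p hp)) (x p ^ E + y ^ (D p))
    (hadd _ _ _ (hpow _ _ _ (hx p hp)) (by rw [mul_comm]; exact hpow _ _ _ hy))
  have hqprime := (hs q hq).1
  by_cases h : q = p
  · subst h
    have h1 : x q ^ E ∈ q := Ideal.pow_mem_of_mem _ (hx2 q hq) _ hE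
    exact hyp (hqprime.mem_of_pow_mem _ ((Ideal.add_mem_iff_right _ h1).1 hzq))
  · have hyq : y ∈ q := by
      rw [hydef, Ideal.IsPrime.prod_mem_iff]
      exact ⟨q, Finset.mem_erase.2 ⟨h, hq⟩, hx2 q hq⟩
    have h1 : y ^ (D p) ∈ q := Ideal.pow_mem_of_mem _ hyq _ (hD p hp)
    exact hx1 p hp q hq h (hqprime.mem_of_pow_mem _ ((Ideal.add_mem_iff_left _ h1).1 hzq))

/-! ### Graded pieces -/

section graded

variable {k : Type} [Field k] {σ : Type} {Γ : Type} [AddCommGroup Γ] (w : σ → Γ)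

/-- `J` is homogeneous for the weights `w`. -/
def HomI (J : Ideal (MvPolynomial σ k)) : Prop :=
  ∀ p ∈ J, ∀ γ, weightedHomogeneousComponent w γ p ∈ J

theorem comp_mul {w : σ → Γ} {g : MvPolynomial σ k} {d : Γ} (hg : IsWeightedHomogeneous w g d)
    (a : MvPolynomial σ k) (γ : Γ) :
    weightedHomogeneousComponent w (d + γ) (g * a) = g * weightedHomogeneousComponent w γ a := by
  classical
  induction a using MvPolynomial.induction_on' with
  | monomial m r =>
    have hm : IsWeightedHomogeneous w (monomial m r) (Finsupp.weight w m) :=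
      isWeightedHomogeneous_monomial _ _ _ rfl
    have hm' := hg.mul hm
    by_cases h : Finsupp.weight w m = γ
    · subst h
      rw [hm'.weightedHomogeneousComponent_same, hm.weightedHomogeneousComponent_same]
    · rw [hm'.weightedHomogeneousComponent_ne, hm.weightedHomogeneousComponent_ne, mul_zero]
      · exact fun h' => h h'.symm
      · exact fun h' => h (add_left_cancel h').symm
  | add p q hp hq => rw [mul_add, map_add, hp, hq, map_add, mul_add]

theorem HomI.sup {w : σ → Γ} {J : Ideal (MvPolynomial σ k)} (hJ : HomI w J)
    {g : MvPolynomial σ k} {d : Γ} (hg : IsWeightedHomogeneous w g d) :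
    HomI w (J ⊔ Ideal.span {g}) := by
  intro p hp γ
  rw [mem_sup_sing] at hp ⊢
  obtain ⟨c, hc⟩ := hp
  refine ⟨weightedHomogeneousComponent w (-d + γ) c, ?_⟩
  rw [← comp_mul hg, add_neg_cancel_left, ← map_sub]
  exact hJ _ hc _

theorem HomI.bot : HomI w (⊥ : Ideal (MvPolynomial σ k)) := by
  intro p hp γ
  rw [Ideal.mem_bot] at hp
  simp [hp]

/-- The ideal of the variables. -/
abbrev mm (k σ : Type) [Field k] : Ideal (MvPolynomial σ k) :=
  Ideal.span (Set.range (X : σ → MvPolynomial σ k))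

/-- `J` has no socle. -/
def DepthPos (J : Ideal (MvPolynomial σ k)) : Prop :=
  ∀ a, (∀ l, X l * a ∈ J) → a ∈ J

/-- The socle modulo `J` is one-dimensional in degree `γ`. -/
def SocOne (J : Ideal (MvPolynomial σ k)) (γ : Γ) : Prop :=
  ∃ s, IsWeightedHomogeneous w s γ ∧ s ∉ J ∧ (∀ l, X l * s ∈ J) ∧
    ∀ a, (∀ l, X l * a ∈ J) → ∃ c : k, a - C c * s ∈ J

theorem mm_mul {J : Ideal (MvPolynomial σ k)} {a v : MvPolynomial σ k}
    (ha : ∀ l, X l * a ∈ J) (hv : v ∈ mm k σ) : v * a ∈ J := by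
  have : mm k σ ≤ J.colon {a} := by
    rw [Ideal.span_le]
    rintro _ ⟨l, rfl⟩
    simpa [Submodule.mem_colon_singleton] using ha l
  simpa [Submodule.mem_colon_singleton] using this hv

theorem mm_of_coeff {p : MvPolynomial σ k} (hp : coeff 0 p = 0) : p ∈ mm k σ := by
  rw [mm, ← Set.image_univ, mem_ideal_span_X_image]
  intro m hm
  by_contra h
  push Not at h
  have : m = 0 := by ext i; exact h i trivial
  subst this
  exact (mem_support_iff.1 hm) hp

theorem mm_coeff {p : MvPolynomial σ k} (hp : p ∈ mm k σ) : coeff 0 p = 0 := by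
  rw [mm, ← Set.image_univ, mem_ideal_span_X_image] at hp
  by_contra h
  obtain ⟨i, _, hi⟩ := hp 0 (mem_support_iff.2 h)
  simp at hi

/-- Socle transfer, raw version. -/
theorem transfer {J : Ideal (MvPolynomial σ k)} {u v a b : MvPolynomial σ k}
    (hu : RegMod J u) (ha : ∀ l, X l * a ∈ J ⊔ Ideal.span {u}) (hab : v * a - u * b ∈ J) (l : σ) :
    X l * b ∈ J ⊔ Ideal.span {v} := by
  obtain ⟨m, hm⟩ := mem_sup_sing.1 (ha l)
  refine mem_sup_sing.2 ⟨m, hu _ ?_⟩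
  have h1 := J.mul_mem_left v hm
  have h2 := J.mul_mem_left (X l) hab
  convert J.sub_mem h1 h2 using 1
  ring

theorem depthPos_exch {J : Ideal (MvPolynomial σ k)} {u v : MvPolynomial σ k}
    (hu : RegMod J u) (hv : RegMod J v) (hum : u ∈ mm k σ)
    (h : DepthPos (J ⊔ Ideal.span {u})) : DepthPos (J ⊔ Ideal.span {v}) := by
  intro a ha
  obtain ⟨b, hb⟩ := mem_sup_sing.1 (mm_mul ha hum)
  obtain ⟨c, hc⟩ := mem_sup_sing.1 (h b (fun l => transfer hv ha hb l))
  refine mem_sup_sing.2 ⟨c, hu _ ?_⟩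
  convert J.add_mem hb (J.mul_mem_left v hc) using 1
  ring

theorem socOne_exch {J : Ideal (MvPolynomial σ k)} {u v : MvPolynomial σ k} {du dv γ : Γ}
    (hJ : HomI w J) (hu : RegMod J u) (hv : RegMod J v) (hum : u ∈ mm k σ) (hvm : v ∈ mm k σ)
    (hud : IsWeightedHomogeneous w u du) (hvd : IsWeightedHomogeneous w v dv)
    (h : SocOne w (J ⊔ Ideal.span {u}) (γ + du)) : SocOne w (J ⊔ Ideal.span {v}) (γ + dv) := by
  obtain ⟨s, hs, hsJ, hsX, hsp⟩ := h
  obtain ⟨t0, ht0⟩ := mem_sup_sing.1 (mm_mul hsX hvm)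
  set t := weightedHomogeneousComponent w (γ + dv) t0 with htdef
  have ht : v * s - u * t ∈ J := by
    have := hJ _ ht0 (du + (γ + dv))
    rw [map_sub, comp_mul hud] at this
    have e : du + (γ + dv) = dv + (γ + du) := by abel
    rw [e, comp_mul hvd, hs.weightedHomogeneousComponent_same] at this
    exact this
  refine ⟨t, weightedHomogeneousComponent_isWeightedHomogeneous _ _, ?_,
    fun l => transfer hu hsX ht l, ?_⟩
  · intro htv
    obtain ⟨c, hc⟩ := mem_sup_sing.1 htv
    apply hsJ
    refine mem_sup_sing.2 ⟨c, hv _ ?_⟩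
    convert J.add_mem ht (J.mul_mem_left u hc) using 1
    ring
  · intro a ha
    obtain ⟨b, hb⟩ := mem_sup_sing.1 (mm_mul ha hum)
    obtain ⟨c, hc⟩ := hsp b (fun l => transfer hv ha hb l)
    refine ⟨c, ?_⟩
    obtain ⟨e, he⟩ := mem_sup_sing.1 hc
    refine mem_sup_sing.2 ⟨e, hu _ ?_⟩
    convert J.add_mem (J.add_mem hb (J.mul_mem_left v he)) (J.mul_mem_left (C c) ht) using 1
    ring

/-! ### Regular sequences -/

/-- Regular sequences of (element, degree) pairs. -/
def RegSeq : Ideal (MvPolynomial σ k) → List (MvPolynomial σ k × Γ) → Prop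
  | _, [] => True
  | J, g :: L => RegMod J g.1 ∧ RegSeq (J ⊔ Ideal.span {g.1}) L

/-- The ideal generated by `J` and the list. -/
def extI : Ideal (MvPolynomial σ k) → List (MvPolynomial σ k × Γ) → Ideal (MvPolynomial σ k)
  | J, [] => J
  | J, g :: L => extI (J ⊔ Ideal.span {g.1}) L

/-- All intermediate ideals. -/
def chainI : Ideal (MvPolynomial σ k) → List (MvPolynomial σ k × Γ) →
    List (Ideal (MvPolynomial σ k))
  | J, [] => [J]
  | J, g :: L => J :: chainI (J ⊔ Ideal.span {g.1}) L

/-- The pair consists of an element in the maximal ideal with its degree. -/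
def Good (g : MvPolynomial σ k × Γ) : Prop := IsWeightedHomogeneous w g.1 g.2 ∧ g.1 ∈ mm k σ

theorem extI_append (J : Ideal (MvPolynomial σ k)) (L M : List (MvPolynomial σ k × Γ)) :
    extI J (L ++ M) = extI (extI J L) M := by
  induction L generalizing J with
  | nil => rfl
  | cons g L ih => exact ih _

theorem extI_eq (J : Ideal (MvPolynomial σ k)) (L : List (MvPolynomial σ k × Γ)) :
    extI J L = J ⊔ Ideal.ofList (L.map Prod.fst) := by
  induction L generalizing J with
  | nil => simp [extI]
  | cons g L ih => rw [extI, ih, List.map_cons, Ideal.ofList_cons, sup_assoc]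

theorem extI_sup (J : Ideal (MvPolynomial σ k)) (z : MvPolynomial σ k)
    (L : List (MvPolynomial σ k × Γ)) :
    extI (J ⊔ Ideal.span {z}) L = extI J L ⊔ Ideal.span {z} := by
  rw [extI_eq, extI_eq, sup_right_comm]

theorem extI_hom {J : Ideal (MvPolynomial σ k)} (hJ : HomI w J)
    {L : List (MvPolynomial σ k × Γ)} (hL : ∀ g ∈ L, Good w g) : HomI w (extI J L) := by
  induction L generalizing J with
  | nil => exact hJ
  | cons g L ih =>
    exact ih (hJ.sup (hL g (by simp)).1) (fun h hh => hL h (by simp [hh]))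

theorem regSeq_append (J : Ideal (MvPolynomial σ k)) (L M : List (MvPolynomial σ k × Γ)) :
    RegSeq J (L ++ M) ↔ RegSeq J L ∧ RegSeq (extI J L) M := by
  induction L generalizing J with
  | nil => simp [RegSeq, extI]
  | cons g L ih => simp only [List.cons_append, RegSeq, extI, ih, and_assoc]

theorem regSeq_iff (J : Ideal (MvPolynomial σ k)) (L : List (MvPolynomial σ k × Γ)) :
    RegSeq J L ↔ ∀ i (h : i < L.length), RegMod (extI J (L.take i)) (L[i]).1 := by
  induction L generalizing J with
  | nil => simp [RegSeq]
  | cons g L ih =>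
    rw [RegSeq, ih]
    constructor
    · rintro ⟨h1, h2⟩ i hi
      cases i with
      | zero => exact h1
      | succ i => exact h2 i (by simpa using hi)
    · intro h
      exact ⟨h 0 (by simp), fun i hi => h (i + 1) (by simpa using hi)⟩

theorem depthPos_of_reg {J : Ideal (MvPolynomial σ k)} {u : MvPolynomial σ k} (hu : RegMod J u)
    (hum : u ∈ mm k σ) : DepthPos J := fun _ ha => hu _ (mm_mul ha hum)

theorem chain_depth {J : Ideal (MvPolynomial σ k)} {L : List (MvPolynomial σ k × Γ)}
    {g : MvPolynomial σ k × Γ} (h : RegSeq J (L ++ [g])) (hL : ∀ x ∈ L ++ [g], Good w x) :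
    ∀ K ∈ chainI J L, DepthPos K := by
  induction L generalizing J with
  | nil =>
    intro K hK
    simp only [chainI, List.mem_singleton] at hK
    subst hK
    exact depthPos_of_reg h.1 (hL g (by simp)).2
  | cons x L ih =>
    intro K hK
    simp only [chainI, List.mem_cons] at hK
    rcases hK with rfl | hK
    · exact depthPos_of_reg h.1 (hL x (by simp)).2
    · exact ih h.2 (fun y hy => hL y (by simp only [List.cons_append, List.mem_cons]; exact Or.inr hy)) K hK

theorem chain_last (J : Ideal (MvPolynomial σ k)) (L : List (MvPolynomial σ k × Γ)) :
    extI J L ∈ chainI J L := by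
  induction L generalizing J with
  | nil => simp [chainI, extI]
  | cons x L ih => simp only [chainI, extI, List.mem_cons]; exact Or.inr (ih _)

theorem reg_swap {J : Ideal (MvPolynomial σ k)} {u z : MvPolynomial σ k} (hu : RegMod J u)
    (hz : RegMod (J ⊔ Ideal.span {u}) z) : RegMod (J ⊔ Ideal.span {z}) u := by
  intro a ha
  obtain ⟨c, hc⟩ := mem_sup_sing.1 ha
  have : z * c ∈ J ⊔ Ideal.span {u} := by
    refine mem_sup_sing.2 ⟨a, ?_⟩
    convert J.neg_mem hc using 1
    ring
  obtain ⟨e, he⟩ := mem_sup_sing.1 (hz _ this)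
  refine mem_sup_sing.2 ⟨e, hu _ ?_⟩
  convert J.add_mem hc (J.mul_mem_left z he) using 1
  ring

theorem reg_move {J : Ideal (MvPolynomial σ k)} {L : List (MvPolynomial σ k × Γ)}
    {z : MvPolynomial σ k} (h : RegSeq J L) (hz : ∀ K ∈ chainI J L, RegMod K z) :
    RegMod J z ∧ RegSeq (J ⊔ Ideal.span {z}) L := by
  induction L generalizing J with
  | nil => exact ⟨hz J (by simp [chainI]), trivial⟩
  | cons x L ih =>
    obtain ⟨h1, h2⟩ := ih h.2 (fun K hK => hz K (by simp only [chainI, List.mem_cons]; exact Or.inr hK))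
    refine ⟨hz J (by simp [chainI]), reg_swap h.1 h1, ?_⟩
    rwa [sup_right_comm]

variable [Finite σ] {η : Γ}

theorem exists_reg (hη : ∀ l, ∃ e : ℕ, 0 < e ∧ e • w l = η)
    (Js : List (Ideal (MvPolynomial σ k))) (hJs : ∀ J ∈ Js, DepthPos J) :
    ∃ d > 0, ∃ z : MvPolynomial σ k, IsWeightedHomogeneous w z (d • η) ∧ ∀ J ∈ Js, RegMod J z := by
  classical
  choose s hs1 hs2 using fun J : Ideal (MvPolynomial σ k) => exists_primes J
  obtain ⟨d, hd, z, hz, hz'⟩ := avoid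
    (fun d => {x : MvPolynomial σ k | IsWeightedHomogeneous w x (d • η)})
    ⟨0, isWeightedHomogeneous_zero _ _ _⟩ (by simpa using isWeightedHomogeneous_one _ _)
    (fun d x y hx hy => hx.add hy) (fun d e x y hx hy => by
      simp only [Set.mem_ofPred_eq, add_smul]; exact hx.mul hy)
    (Js.toFinset.biUnion s) (by
      intro p hp
      simp only [Finset.mem_biUnion, List.mem_toFinset] at hp
      obtain ⟨J, hJ, hp⟩ := hp
      obtain ⟨hpr, a, haJ, ha⟩ := hs1 J p hp
      refine ⟨hpr, ?_⟩
      have : ∃ l, X l ∉ p := by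
        by_contra hcon
        push Not at hcon
        exact haJ (hJs J hJ a (fun l => (ha _).1 (hcon l)))
      obtain ⟨l, hl⟩ := this
      obtain ⟨e, he, hel⟩ := hη l
      refine ⟨1, one_pos, X l ^ e, ?_, fun h => hl (hpr.mem_of_pow_mem _ h)⟩
      simp only [Set.mem_ofPred_eq, one_smul, ← hel]
      exact (isWeightedHomogeneous_X _ _ _).pow e)
  refine ⟨d, hd, z, hz, fun J hJ => hs2 J z fun p hp => hz' p ?_⟩
  simp only [Finset.mem_biUnion, List.mem_toFinset]
  exact ⟨J, hJ, hp⟩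

theorem hom_mm {z : MvPolynomial σ k} {γ : Γ} (hz : IsWeightedHomogeneous w z γ) (hγ : γ ≠ 0) :
    z ∈ mm k σ := by
  apply mm_of_coeff
  by_contra h
  exact hγ (by simpa using (hz h).symm)

theorem exchange (hη : ∀ l, ∃ e : ℕ, 0 < e ∧ e • w l = η)
    (hη0 : ∀ d : ℕ, 0 < d → d • η ≠ 0) (P : Ideal (MvPolynomial σ k) → Γ → Prop)
    (hP : ∀ J (u v : MvPolynomial σ k × Γ) γ, HomI w J → Good w u → Good w v → RegMod J u.1 →
      RegMod J v.1 → P (J ⊔ Ideal.span {u.1}) (γ + u.2) → P (J ⊔ Ideal.span {v.1}) (γ + v.2))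
    (r : ℕ) : ∀ (J : Ideal (MvPolynomial σ k)) (G H : List (MvPolynomial σ k × Γ)) (γ : Γ),
      HomI w J → G.length = r → H.length = r → (∀ g ∈ G, Good w g) → (∀ g ∈ H, Good w g) →
      RegSeq J G → RegSeq J H → P (extI J H) (γ + (H.map Prod.snd).sum) →
      P (extI J G) (γ + (G.map Prod.snd).sum) := by
  induction r with
  | zero =>
    intro J G H γ hJ hG hH _ _ _ _ hh
    rw [List.length_eq_zero_iff] at hG hH
    subst hG hH
    exact hh
  | succ r ih =>
    intro J G H γ hJ hGl hHl hG hH hGr hHr hh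
    obtain ⟨G', g, rfl⟩ : ∃ G' g, G = G' ++ [g] :=
      ⟨_, _, (List.dropLast_append_getLast (by rintro rfl; simp at hGl)).symm⟩
    obtain ⟨H', h, rfl⟩ : ∃ G' g, H = G' ++ [g] :=
      ⟨_, _, (List.dropLast_append_getLast (by rintro rfl; simp at hHl)).symm⟩
    obtain ⟨d, hd, z, hz, hzr⟩ := exists_reg w hη (chainI J G' ++ chainI J H') (by
      intro K hK
      rcases List.mem_append.1 hK with hK | hK
      · exact chain_depth w hGr hG K hK
      · exact chain_depth w hHr hH K hK)
    have hzg : Good w (z, d • η) := ⟨hz, hom_mm w hz (hη0 d hd)⟩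
    rw [regSeq_append] at hGr hHr
    have mG := reg_move hGr.1 (fun K hK => hzr K (List.mem_append_left _ hK))
    have mH := reg_move hHr.1 (fun K hK => hzr K (List.mem_append_right _ hK))
    have hG' : ∀ x ∈ G', Good w x := fun x hx => hG x (List.mem_append_left _ hx)
    have hH' : ∀ x ∈ H', Good w x := fun x hx => hH x (List.mem_append_left _ hx)
    have eG : extI J (G' ++ [g]) = extI J G' ⊔ Ideal.span {g.1} := by rw [extI_append]; rfl
    have eH : extI J (H' ++ [h]) = extI J H' ⊔ Ideal.span {h.1} := by rw [extI_append]; rfl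
    have s1 := hP (extI J H') h (z, d • η) (γ + (H'.map Prod.snd).sum) (extI_hom w hJ hH')
      (hH h (by simp)) hzg hHr.2.1 (hzr _ (List.mem_append_right _ (chain_last _ _)))
      (by rw [← eH]; simpa [add_assoc] using hh)
    have s2 := ih (J ⊔ Ideal.span {z}) G' H' (γ + d • η) (hJ.sup hz) (by simpa using hGl)
      (by simpa using hHl) hG' hH' mG.2 mH.2 (by
        rw [extI_sup, add_right_comm]; exact s1)
    rw [extI_sup, add_right_comm] at s2
    have s3 := hP (extI J G') (z, d • η) g (γ + (G'.map Prod.snd).sum) (extI_hom w hJ hG')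
      hzg (hG g (by simp)) (hzr _ (List.mem_append_left _ (chain_last _ _))) hGr.2.1 s2
    rw [eG]
    simpa [add_assoc] using s3

/-! ### Dimension theory and the variables -/

theorem krull_reg {J : Ideal (MvPolynomial σ k)} {L : List (MvPolynomial σ k × Γ)}
    (h : RegSeq J L) :
    ringKrullDim (MvPolynomial σ k ⧸ extI J L) + (L.length : ℕ) ≤
      ringKrullDim (MvPolynomial σ k ⧸ J) := by
  induction L generalizing J with
  | nil =>
    simp only [List.length_nil, Nat.cast_zero, add_zero]
    exact le_rfl
  | cons g L ih =>
    have h1 := ih h.2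
    have h2 : ringKrullDim (MvPolynomial σ k ⧸ (J ⊔ Ideal.span {g.1})) + 1 ≤
        ringKrullDim (MvPolynomial σ k ⧸ J) := by
      refine ringKrullDim_succ_le_of_surjective
        (Ideal.Quotient.factor (le_sup_left : J ≤ J ⊔ Ideal.span {g.1}))
        (Ideal.Quotient.factor_surjective _) (r := Ideal.Quotient.mk J g.1) ?_ ?_
      · rw [mem_nonZeroDivisors_iff_right]
        intro x hx
        obtain ⟨a, rfl⟩ := Ideal.Quotient.mk_surjective x
        rw [← map_mul, Ideal.Quotient.eq_zero_iff_mem, mul_comm] at hx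
        exact Ideal.Quotient.eq_zero_iff_mem.2 (h.1 _ hx)
      · rw [Ideal.Quotient.factor_mk, Ideal.Quotient.eq_zero_iff_mem]
        exact Ideal.mem_sup_right (Ideal.mem_span_singleton_self _)
    refine le_trans ?_ h2
    rw [extI, List.length_cons, Nat.cast_succ, ← add_assoc]
    gcongr

theorem extI_le_mm {L : List (MvPolynomial σ k × Γ)} (hL : ∀ g ∈ L, Good w g) :
    extI ⊥ L ≤ mm k σ := by
  rw [extI_eq, bot_sup_eq, Ideal.ofList, Ideal.span_le]
  intro x hx
  obtain ⟨g, hg, rfl⟩ := List.mem_map.1 hx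
  exact (hL g hg).2

theorem one_notMem_mm : (1 : MvPolynomial σ k) ∉ mm k σ := by
  intro h
  simpa using mm_coeff h

theorem krull_A : ringKrullDim (MvPolynomial σ k ⧸ (⊥ : Ideal (MvPolynomial σ k))) =
    (Nat.card σ : ℕ) := by
  rw [ringKrullDim_eq_of_ringEquiv (RingEquiv.quotientBot _),
    MvPolynomial.ringKrullDim_of_isNoetherianRing, ringKrullDim_eq_zero_of_field, zero_add]

theorem reg_length_le {L : List (MvPolynomial σ k × Γ)} (hL : ∀ g ∈ L, Good w g)
    (h : RegSeq ⊥ L) : L.length ≤ Nat.card σ := by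
  have h1 := krull_reg h
  rw [krull_A] at h1
  have : Nontrivial (MvPolynomial σ k ⧸ extI ⊥ L) := by
    rw [Ideal.Quotient.nontrivial_iff]
    intro h
    exact one_notMem_mm (extI_le_mm w hL (h ▸ Submodule.mem_top))
  have h2 : 0 ≤ ringKrullDim (MvPolynomial σ k ⧸ extI ⊥ L) := ringKrullDim_nonneg_of_nontrivial
  have h3 : (0 : WithBot ℕ∞) + (L.length : ℕ) ≤ (Nat.card σ : ℕ) := le_trans (by gcongr) h1
  rw [zero_add] at h3
  exact_mod_cast h3

theorem reg_finite {L : List (MvPolynomial σ k × Γ)}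
    (h : RegSeq ⊥ L) (hl : L.length = Nat.card σ) :
    Module.Finite k (MvPolynomial σ k ⧸ extI ⊥ L) := by
  have h1 := krull_reg h
  rw [krull_A, hl] at h1
  have h2 : ringKrullDim (MvPolynomial σ k ⧸ extI ⊥ L) ≤ 0 := by
    generalize ringKrullDim (MvPolynomial σ k ⧸ extI ⊥ L) = x at h1
    induction x using WithBot.recBotCoe with
    | bot => exact bot_le
    | coe x =>
      induction x using ENat.recTopCoe with
      | top => 
        exfalso
        have : ((⊤ : ℕ∞) + ((Nat.card σ : ℕ) : ℕ∞)) ≤ ((Nat.card σ : ℕ) : ℕ∞) := by exact_mod_cast h1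
        rw [top_add, top_le_iff] at this
        exact ENat.natCast_ne_top _ this
      | coe x =>
        have : x + Nat.card σ ≤ Nat.card σ := by exact_mod_cast h1
        have : x = 0 := by omega
        subst this
        simp
  have : Ring.KrullDimLE 0 (MvPolynomial σ k ⧸ extI ⊥ L) := Ring.krullDimLE_iff.mpr (by simpa using h2)
  exact (Module.finite_iff_krullDimLE_zero _ _).2 this

theorem X_reg {s : Set σ} {t : σ} (ht : t ∉ s) :
    RegMod (Ideal.span (X '' s : Set (MvPolynomial σ k))) (X t) := by
  intro a ha
  rw [mem_ideal_span_X_image] at ha ⊢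
  intro m hm
  obtain ⟨i, hi, him⟩ := ha (m + Finsupp.single t 1) (by
    rw [mem_support_iff, add_comm, coeff_X_mul]
    exact mem_support_iff.1 hm)
  refine ⟨i, hi, ?_⟩
  have : t ≠ i := fun h => ht (h ▸ hi)
  simpa [Finsupp.single_apply, this] using him

theorem extI_X (M : List σ) :
    extI ⊥ (M.map fun l => ((X l : MvPolynomial σ k), w l)) =
      Ideal.span (X '' {l | l ∈ M}) := by
  rw [extI_eq, bot_sup_eq, Ideal.ofList]
  congr 1
  ext x
  simp

theorem regSeq_X (M : List σ) (hM : M.Nodup) :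
    RegSeq ⊥ (M.map fun l => ((X l : MvPolynomial σ k), w l)) := by
  induction M using List.reverseRecOn with
  | nil => trivial
  | append_singleton M t ih =>
    rw [List.map_append, regSeq_append]
    have hM' := List.nodup_append.1 hM
    refine ⟨ih hM'.1, ?_, trivial⟩
    rw [extI_X]
    apply X_reg
    intro h
    exact hM'.2.2 t h t (by simp) rfl

theorem X_good (M : List σ) : ∀ g ∈ (M.map fun l => ((X l : MvPolynomial σ k), w l)), Good w g := by
  intro g hg
  obtain ⟨l, -, rfl⟩ := List.mem_map.1 hg
  exact ⟨isWeightedHomogeneous_X _ _ _, Ideal.subset_span ⟨l, rfl⟩⟩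

theorem depthPos_of_lt [Fintype σ] (hη : ∀ l, ∃ e : ℕ, 0 < e ∧ e • w l = η)
    (hη0 : ∀ d : ℕ, 0 < d → d • η ≠ 0) {L : List (MvPolynomial σ k × Γ)}
    (hL : ∀ g ∈ L, Good w g) (h : RegSeq ⊥ L) (hl : L.length < Fintype.card σ) :
    DepthPos (extI ⊥ L) := by
  set N := (Finset.univ : Finset σ).toList with hN
  have hNn : N.Nodup := Finset.nodup_toList _
  have hNl : N.length = Fintype.card σ := by rw [hN, Finset.length_toList, Finset.card_univ]
  set M := N.take L.length with hM
  have hMn : M.Nodup := hNn.sublist (List.take_sublist _ _)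
  have hMl : M.length = L.length := by rw [hM, List.length_take]; omega
  refine exchange w hη hη0 (fun J _ => DepthPos J)
    (fun J u v γ _ hu hv hur hvr hh => depthPos_exch hur hvr hu.2 hh) L.length ⊥ L
    (M.map fun l => ((X l : MvPolynomial σ k), w l)) 0 (HomI.bot w) rfl (by simpa using hMl) hL
    (X_good w M) h (regSeq_X w M hMn) ?_
  show DepthPos _
  rw [extI_X]
  obtain ⟨t, ht⟩ : ∃ t, t ∉ M := by
    by_contra hcon
    push Not at hcon
    have : Fintype.card σ ≤ M.length := by
      classical
      calc Fintype.card σ = M.toFinset.card := by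
            rw [← Finset.card_univ]; congr 1; symm; ext x; simp [hcon]
        _ ≤ M.length := M.toFinset_card_le
    omega
  exact depthPos_of_reg (X_reg (by simpa using ht)) (Ideal.subset_span ⟨t, rfl⟩)

theorem socOne_of_eq [Fintype σ] (hη : ∀ l, ∃ e : ℕ, 0 < e ∧ e • w l = η)
    (hη0 : ∀ d : ℕ, 0 < d → d • η ≠ 0) {L : List (MvPolynomial σ k × Γ)}
    (hL : ∀ g ∈ L, Good w g) (h : RegSeq ⊥ L) (hl : L.length = Fintype.card σ) :
    SocOne w (extI ⊥ L) (-(∑ l, w l) + (L.map Prod.snd).sum) := by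
  set N := (Finset.univ : Finset σ).toList with hN
  have hNn : N.Nodup := Finset.nodup_toList _
  have hNl : N.length = Fintype.card σ := by rw [hN, Finset.length_toList, Finset.card_univ]
  refine exchange w hη hη0 (fun J γ => SocOne w J γ)
    (fun J u v γ hJ hu hv hur hvr hh => socOne_exch w hJ hur hvr hu.2 hv.2 hu.1 hv.1 hh)
    L.length ⊥ L
    (N.map fun l => ((X l : MvPolynomial σ k), w l)) _ (HomI.bot w) rfl (by simp [hNl, hl]) hL
    (X_good w N) h (regSeq_X w N hNn) ?_
  show SocOne w _ _
  rw [extI_X]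
  have e1 : ((N.map fun l => ((X l : MvPolynomial σ k), w l)).map Prod.snd).sum = ∑ l, w l := by
    rw [List.map_map, hN]
    exact Finset.sum_map_toList _ w
  have e2 : (X '' {l | l ∈ N} : Set (MvPolynomial σ k)) = Set.range X := by
    ext x; simp [hN]
  rw [e1, e2, neg_add_cancel]
  refine ⟨1, isWeightedHomogeneous_one _ _, one_notMem_mm, ?_, ?_⟩
  · intro l
    rw [mul_one]
    exact Ideal.subset_span ⟨l, rfl⟩
  · intro a _
    refine ⟨coeff 0 a, mm_of_coeff ?_⟩
    simp

theorem exists_ext [Fintype σ] (hη : ∀ l, ∃ e : ℕ, 0 < e ∧ e • w l = η)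
    (hη0 : ∀ d : ℕ, 0 < d → d • η ≠ 0) (r : ℕ) : ∀ {L : List (MvPolynomial σ k × Γ)},
    (∀ g ∈ L, Good w g) → RegSeq ⊥ L → L.length + r = Fintype.card σ →
    ∃ T : List (MvPolynomial σ k × ℕ), T.length = r ∧
      (∀ t ∈ T, IsWeightedHomogeneous w t.1 (t.2 • η) ∧ 0 < t.2) ∧
      RegSeq ⊥ (L ++ T.map fun t => (t.1, t.2 • η)) := by
  induction r with
  | zero => 
    intro L hL h hl
    exact ⟨[], rfl, by simp, by simpa using h⟩
  | succ r ih =>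
    intro L hL h hl
    obtain ⟨d, hd, z, hz, hzr⟩ := exists_reg w hη [extI ⊥ L] (by
      simpa using depthPos_of_lt w hη hη0 hL h (by omega))
    obtain ⟨T, hT, hT1, hT2⟩ := ih (L := L ++ [(z, d • η)]) (by
      intro g hg
      rcases List.mem_append.1 hg with hg | hg
      · exact hL g hg
      · simp only [List.mem_singleton] at hg
        subst hg
        exact ⟨hz, hom_mm w hz (hη0 d hd)⟩) (by
      rw [regSeq_append]
      exact ⟨h, hzr _ (by simp), trivial⟩) (by simp; omega)
    refine ⟨(z, d) :: T, by simp [hT], ?_, by simpa using hT2⟩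
    intro t ht
    rcases List.mem_cons.1 ht with rfl | ht
    · exact ⟨hz, hd⟩
    · exact hT1 t ht

/-- Homogeneous ideals of finite codimension contain powers of the variables. -/
theorem X_pow_mem (hη : ∀ l, ∃ e : ℕ, 0 < e ∧ e • w l = η)
    (hη0 : ∀ d : ℕ, 0 < d → d • η ≠ 0) {J : Ideal (MvPolynomial σ k)} (hJ : HomI w J)
    (hfin : Module.Finite k (MvPolynomial σ k ⧸ J)) (l : σ) : ∃ e : ℕ, X l ^ e ∈ J := by
  classical
  have hinj : ∀ i j : ℕ, i • w l = j • w l → i = j := by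
    obtain ⟨e, he, hel⟩ := hη l
    have key : ∀ i d : ℕ, (i + d) • w l = i • w l → d = 0 := by
      intro i d h
      rw [add_smul, add_eq_left] at h
      by_contra hd
      apply hη0 d (Nat.pos_of_ne_zero hd)
      rw [← hel, smul_comm, h, smul_zero]
    intro i j h
    rcases Nat.le_total i j with hij | hij
    · obtain ⟨d, rfl⟩ := Nat.exists_eq_add_of_le hij
      have := key i d h.symm; omega
    · obtain ⟨d, rfl⟩ := Nat.exists_eq_add_of_le hij
      have := key j d h; omega
  by_contra hcon
  push Not at hcon
  have hli : LinearIndependent k fun e : ℕ => Ideal.Quotient.mkₐ k J (X l ^ e) := by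
    rw [linearIndependent_iff']
    intro s c hc i hi
    have h1 : ∑ e ∈ s, C (c e) * X l ^ e ∈ J := by
      rw [← Ideal.Quotient.eq_zero_iff_mem, ← hc, map_sum]
      refine Finset.sum_congr rfl fun e _ => ?_
      rw [← map_smul, smul_eq_C_mul]
      rfl
    have h2 := hJ _ h1 (i • w l)
    rw [map_sum, Finset.sum_eq_single i] at h2
    · rw [weightedHomogeneousComponent_C_mul,
        ((isWeightedHomogeneous_X k w l).pow i).weightedHomogeneousComponent_same] at h2
      by_contra hci
      apply hcon i
      have := J.mul_mem_left (C (c i)⁻¹) h2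
      rwa [← mul_assoc, ← C_mul, inv_mul_cancel₀ hci, C_1, one_mul] at this
    · intro e _ hei
      rw [weightedHomogeneousComponent_C_mul,
        ((isWeightedHomogeneous_X k w l).pow e).weightedHomogeneousComponent_ne, mul_zero]
      exact fun h => hei (hinj _ _ h).symm
    · exact fun h => absurd hi h
  have := hli.finite
  exact not_finite ℕ

/-- Every nonzero ideal meets the socle. -/
theorem essential {J : Ideal (MvPolynomial σ k)} (hpow : ∀ l, ∃ e : ℕ, X l ^ e ∈ J)
    {p : MvPolynomial σ k} (hp : p ∉ J) : ∃ q, q * p ∉ J ∧ ∀ l, X l * (q * p) ∈ J := by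
  classical
  have hrad : mm k σ ≤ J.radical := by
    rw [Ideal.span_le]
    rintro _ ⟨l, rfl⟩
    exact hpow l
  obtain ⟨N, hN⟩ := Ideal.exists_pow_le_of_le_radical_of_fg hrad (IsNoetherian.noetherian _)
  have hex : ∃ N, ∀ q ∈ mm k σ ^ N, q * p ∈ J := ⟨N, fun q hq => J.mul_mem_right _ (hN hq)⟩
  set N := Nat.find hex with hNd
  have h1 := Nat.find_spec hex
  rw [← hNd] at h1
  obtain ⟨M, hM⟩ : ∃ M, N = M + 1 := by
    refine Nat.exists_eq_succ_of_ne_zero fun h0 => hp ?_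
    rw [h0] at h1
    simpa using h1 1 (by simp)
  have h2 := Nat.find_min hex (m := M) (by omega)
  push Not at h2
  obtain ⟨q, hq, hqp⟩ := h2
  refine ⟨q, hqp, fun l => ?_⟩
  rw [← mul_assoc]
  apply h1
  rw [hM, pow_succ']
  exact Ideal.mul_mem_mul (Ideal.subset_span ⟨l, rfl⟩) hq

end graded

/-! ### The multi-Veronese subring -/

section veronese

variable {k : Type} [Field k] {n : ℕ} {a : Fin n → ℕ}

/-- The degree map to `∏ ℤ/bᵢ × ℚ`. -/
def phi (b : Fin n → ℕ) : (Fin n → ℕ) →+ ((∀ i, ZMod (b i)) × ℚ) where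
  toFun d := (fun i => (d i : ZMod (b i)), ∑ i, (d i : ℚ) / (b i : ℚ))
  map_zero' := by ext <;> simp
  map_add' x y := by
    ext
    · simp
    · simp [add_div, Finset.sum_add_distrib]

/-- The combined weight. -/
def wt (a b : Fin n → ℕ) : ((i : Fin n) × Fin (a i + 1)) → ((∀ i, ZMod (b i)) × ℚ) :=
  fun l => phi b (coxWeight n a l)

/-- The torsion weight. -/
def wG (a b : Fin n → ℕ) : ((i : Fin n) × Fin (a i + 1)) → (∀ i, ZMod (b i)) :=
  fun l => (phi b (coxWeight n a l)).1

/-- The degree of the generators of the Veronese. -/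
def eta (b : Fin n → ℕ) : (∀ i, ZMod (b i)) × ℚ := (0, 1)

theorem weight_comp {σ M N : Type} [AddCommMonoid M] [AddCommMonoid N] (f : M →+ N) (w : σ → M)
    (m : σ →₀ ℕ) : Finsupp.weight (fun l => f (w l)) m = f (Finsupp.weight w m) := by
  rw [Finsupp.weight_apply, Finsupp.weight_apply, Finsupp.sum, Finsupp.sum, map_sum]
  simp

theorem weight_wt (b : Fin n → ℕ) (m : ((i : Fin n) × Fin (a i + 1)) →₀ ℕ) :
    Finsupp.weight (wt a b) m = phi b (Finsupp.weight (coxWeight n a) m) :=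
  weight_comp (phi b) _ m

theorem weight_wG (b : Fin n → ℕ) (m : ((i : Fin n) × Fin (a i + 1)) →₀ ℕ) :
    Finsupp.weight (wG a b) m = (phi b (Finsupp.weight (coxWeight n a) m)).1 :=
  weight_comp ((AddMonoidHom.fst _ _).comp (phi b)) _ m

theorem weight_cox (m : ((i : Fin n) × Fin (a i + 1)) →₀ ℕ) (i : Fin n) :
    Finsupp.weight (coxWeight n a) m i = ∑ j, m ⟨i, j⟩ := by
  classical
  rw [Finsupp.weight_apply, Finsupp.sum_fintype _ _ (by simp), Fintype.sum_sigma,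
    Finset.sum_apply, Finset.sum_eq_single i]
  · simp [coxWeight]
  · intro i' _ hi
    simp [coxWeight, hi.symm]
  · simp

theorem phi_single (b : Fin n → ℕ) (hb : ∀ i, 0 < b i) (i : Fin n) :
    phi b (Pi.single i (b i)) = eta b := by
  classical
  ext j
  · by_cases h : j = i
    · subst h; simp [phi, eta]
    · simp [phi, eta, h]
  · have : (b i : ℚ) ≠ 0 := by exact_mod_cast (hb i).ne'
    simp only [phi, eta, AddMonoidHom.coe_mk, ZeroHom.coe_mk]
    rw [Finset.sum_eq_single i]
    · simp [this]
    · intro j _ hj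
      simp [hj]
    · simp

theorem eta_smul (b : Fin n → ℕ) (s : ℕ) : s • eta b = (0, (s : ℚ)) := by
  ext <;> simp [eta]

theorem phi_eq {b : Fin n → ℕ} (hb : ∀ i, 0 < b i) {d : Fin n → ℕ} {s : ℕ}
    (h : phi b d = s • eta b) : ∃ t : Fin n → ℕ, d = (fun i => b i * t i) ∧ ∑ i, t i = s := by
  rw [eta_smul] at h
  have h1 : ∀ i, b i ∣ d i := fun i => by
    have := congrFun (congrArg Prod.fst h) i
    exact (ZMod.natCast_eq_zero_iff _ _).1 this
  choose t ht using h1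
  refine ⟨t, funext ht, ?_⟩
  have h2 : ∑ i, (d i : ℚ) / (b i : ℚ) = s := congrArg Prod.snd h
  have h3 : ∀ i, (d i : ℚ) / (b i : ℚ) = t i := fun i => by
    have : (b i : ℚ) ≠ 0 := by exact_mod_cast (hb i).ne'
    rw [ht i]; push_cast; field_simp
  simp only [h3] at h2
  exact_mod_cast h2

/-- Degree zero for the torsion weight. -/
abbrev A0 (b : Fin n → ℕ) (p : MvPolynomial ((i : Fin n) × Fin (a i + 1)) k) : Prop :=
  IsWeightedHomogeneous (wG a b) p 0

theorem hom_wt_of_cox {b : Fin n → ℕ} {p : MvPolynomial ((i : Fin n) × Fin (a i + 1)) k}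
    {d : Fin n → ℕ} (h : IsWeightedHomogeneous (coxWeight n a) p d) :
    IsWeightedHomogeneous (wt a b) p (phi b d) := by
  intro m hm
  rw [weight_wt, h hm]

theorem hom_wG_of_wt {b : Fin n → ℕ} {p : MvPolynomial ((i : Fin n) × Fin (a i + 1)) k}
    {d : (∀ i, ZMod (b i)) × ℚ} (h : IsWeightedHomogeneous (wt a b) p d) :
    IsWeightedHomogeneous (wG a b) p d.1 := by
  intro m hm
  rw [weight_wG, ← weight_wt, h hm]

theorem A0_of_wt {b : Fin n → ℕ} {p : MvPolynomial ((i : Fin n) × Fin (a i + 1)) k}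
    {s : ℕ} (h : IsWeightedHomogeneous (wt a b) p (s • eta b)) : A0 b p := by
  have := hom_wG_of_wt h
  rwa [eta_smul] at this

theorem A0_monomial {b : Fin n → ℕ} {m : ((i : Fin n) × Fin (a i + 1)) →₀ ℕ} :
    (∀ i, b i ∣ Finsupp.weight (coxWeight n a) m i) ↔ Finsupp.weight (wG a b) m = 0 := by
  rw [weight_wG, funext_iff]
  exact forall_congr' fun i => (ZMod.natCast_eq_zero_iff _ _).symm

variable (I : Ideal (MvPolynomial ((i : Fin n) × Fin (a i + 1)) k)) (b : Fin n → ℕ)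

theorem mk_mem_Tb {p : MvPolynomial ((i : Fin n) × Fin (a i + 1)) k} (hp : A0 b p) :
    Ideal.Quotient.mk I p ∈ Tb I b := by
  rw [p.as_sum, map_sum]
  refine Subalgebra.sum_mem _ fun m hm => ?_
  have : Ideal.Quotient.mk I (monomial m (coeff m p)) =
      (coeff m p) • Ideal.Quotient.mk I (monomial m 1) := by
    have h : monomial m (coeff m p) = (coeff m p) • monomial m (1 : k) := by
      rw [smul_monomial, smul_eq_mul, mul_one]
    rw [h]
    rfl
  rw [this]
  have hmem : Ideal.Quotient.mk I (monomial m (1 : k)) ∈ Tb I b := by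
    rw [Tb]
    apply Algebra.subset_adjoin
    exact ⟨m, A0_monomial.2 (hp (mem_support_iff.1 hm)), rfl⟩
  exact Subalgebra.smul_mem _ hmem _

theorem exists_of_mem_Tb {y : MvPolynomial ((i : Fin n) × Fin (a i + 1)) k ⧸ I}
    (hy : y ∈ Tb I b) : ∃ p, A0 b p ∧ Ideal.Quotient.mk I p = y := by
  induction hy using Algebra.adjoin_induction with
  | mem x hx =>
    obtain ⟨m, hm, rfl⟩ := hx
    exact ⟨_, isWeightedHomogeneous_monomial _ _ _ (A0_monomial.1 hm), rfl⟩
  | algebraMap r => exact ⟨C r, isWeightedHomogeneous_C _ _, rfl⟩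
  | add x y _ _ hx hy =>
    obtain ⟨p, hp, rfl⟩ := hx
    obtain ⟨q, hq, rfl⟩ := hy
    exact ⟨p + q, hp.add hq, map_add _ _ _⟩
  | mul x y _ _ hx hy =>
    obtain ⟨p, hp, rfl⟩ := hx
    obtain ⟨q, hq, rfl⟩ := hy
    exact ⟨p * q, by simpa using hp.mul hq, map_mul _ _ _⟩

theorem mk_mem_piece (hb : ∀ i, 0 < b i) {p : MvPolynomial ((i : Fin n) × Fin (a i + 1)) k} {s : ℕ}
    (hp : IsWeightedHomogeneous (wt a b) p (s • eta b)) :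
    Ideal.Quotient.mk I p ∈ TbPiece I b s := by
  rw [p.as_sum, map_sum]
  refine Submodule.sum_mem _ fun m hm => ?_
  have h1 := hp (mem_support_iff.1 hm)
  rw [weight_wt] at h1
  obtain ⟨t, ht, hts⟩ := phi_eq hb h1
  refine Submodule.mem_iSup_of_mem t (Submodule.mem_iSup_of_mem
    (Finset.Nat.mem_antidiagonalTuple.2 hts) ?_)
  exact ⟨monomial m (coeff m p), isWeightedHomogeneous_monomial _ _ _ ht, rfl⟩

open Classical in
/-- Lift to the Veronese subring. -/
def toTb (p : MvPolynomial ((i : Fin n) × Fin (a i + 1)) k) : Tb I b :=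
  if h : A0 b p then ⟨Ideal.Quotient.mk I p, mk_mem_Tb I b h⟩ else 0

variable {b}

theorem toTb_val {p : MvPolynomial ((i : Fin n) × Fin (a i + 1)) k} (hp : A0 b p) :
    (toTb I b p : MvPolynomial ((i : Fin n) × Fin (a i + 1)) k ⧸ I) = Ideal.Quotient.mk I p := by
  rw [toTb, dif_pos hp]

theorem toTb_add {p q : MvPolynomial ((i : Fin n) × Fin (a i + 1)) k} (hp : A0 b p)
    (hq : A0 b q) : toTb I b (p + q) = toTb I b p + toTb I b q := by
  apply Subtype.ext
  rw [Subalgebra.coe_add, toTb_val I hp, toTb_val I hq, toTb_val I (hp.add hq), map_add]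

theorem toTb_mul {p q : MvPolynomial ((i : Fin n) × Fin (a i + 1)) k} (hp : A0 b p)
    (hq : A0 b q) : toTb I b (p * q) = toTb I b p * toTb I b q := by
  have h : A0 b (p * q) := by simpa using hp.mul hq
  apply Subtype.ext
  rw [Subalgebra.coe_mul, toTb_val I hp, toTb_val I hq, toTb_val I h, map_mul]

theorem toTb_smul {p : MvPolynomial ((i : Fin n) × Fin (a i + 1)) k} (hp : A0 b p)
    (c : k) : toTb I b (C c * p) = c • toTb I b p := by
  apply Subtype.ext
  rw [Subalgebra.coe_smul, toTb_val I hp, toTb_val I (hp.C_mul c), ← smul_eq_C_mul]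
  rfl

theorem exists_toTb (y : Tb I b) : ∃ p, A0 b p ∧ toTb I b p = y := by
  obtain ⟨p, hp, h⟩ := exists_of_mem_Tb I b y.2
  exact ⟨p, hp, Subtype.ext (by rw [toTb_val I hp, h])⟩

variable {I}

theorem homI_ofList (hI : HomI (wG a b) I)
    {T : List (MvPolynomial ((i : Fin n) × Fin (a i + 1)) k)} (hT : ∀ t ∈ T, A0 b t) :
    HomI (wG a b) (I ⊔ Ideal.ofList T) := by
  induction T generalizing I with
  | nil => simpa using hI
  | cons t T ih =>
    rw [Ideal.ofList_cons, ← sup_assoc]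
    exact ih (hI.sup (hT t (by simp))) (fun s hs => hT s (by simp [hs]))

theorem key (hI : HomI (wG a b) I) {T : List (MvPolynomial ((i : Fin n) × Fin (a i + 1)) k)}
    (hT : ∀ t ∈ T, A0 b t) {p : MvPolynomial ((i : Fin n) × Fin (a i + 1)) k} (hp : A0 b p) :
    toTb I b p ∈ Ideal.ofList (T.map (toTb I b)) ↔ p ∈ I ⊔ Ideal.ofList T := by
  constructor
  · intro h
    have h1 : Ideal.ofList (T.map (toTb I b)) ≤
        ((I ⊔ Ideal.ofList T).map (Ideal.Quotient.mk I)).comap (Tb I b).val.toRingHom := by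
      rw [Ideal.ofList, Ideal.span_le]
      intro x hx
      obtain ⟨t, ht, rfl⟩ := List.mem_map.1 hx
      rw [SetLike.mem_coe, Ideal.mem_comap]
      change (toTb I b t : MvPolynomial ((i : Fin n) × Fin (a i + 1)) k ⧸ I) ∈ _
      rw [toTb_val I (hT t ht)]
      exact Ideal.mem_map_of_mem _ (Ideal.mem_sup_right (Ideal.subset_span ht))
    have h2 := h1 h
    rw [Ideal.mem_comap] at h2
    change (toTb I b p : MvPolynomial ((i : Fin n) × Fin (a i + 1)) k ⧸ I) ∈ _ at h2
    rw [toTb_val I hp] at h2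
    exact (Ideal.mem_quotient_iff_mem le_sup_left).1 h2
  · induction T generalizing p with
    | nil =>
      intro h
      rw [Ideal.ofList_nil, sup_bot_eq] at h
      have : toTb I b p = 0 := by
        apply Subtype.ext
        rw [toTb_val I hp]
        exact Ideal.Quotient.eq_zero_iff_mem.2 h
      rw [this]
      exact Ideal.zero_mem _
    | cons t T ih =>
      intro h
      have ht : A0 b t := hT t (by simp)
      have hT' : ∀ s ∈ T, A0 b s := fun s hs => hT s (by simp [hs])
      rw [Ideal.ofList_cons, sup_left_comm, sup_comm, mem_sup_sing] at h
      obtain ⟨c, hc⟩ := h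
      have h1 := homI_ofList hI hT' _ hc 0
      set c0 := weightedHomogeneousComponent (wG a b) 0 c with hc0
      have hc0A : A0 b c0 := weightedHomogeneousComponent_isWeightedHomogeneous _ _
      have e := comp_mul ht c 0
      rw [add_zero] at e
      rw [map_sub, e, hp.weightedHomogeneousComponent_same] at h1
      have htc : A0 b (t * c0) := by simpa using ht.mul hc0A
      have h2 := ih hT' (hp.sub htc) h1
      have h3 : toTb I b p = toTb I b (p - t * c0) + toTb I b t * toTb I b c0 := by
        rw [← toTb_mul I ht hc0A, ← toTb_add I (hp.sub htc) htc, sub_add_cancel]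
      rw [h3, List.map_cons, Ideal.ofList_cons]
      exact Ideal.add_mem _ (Ideal.mem_sup_right h2) (Ideal.mem_sup_left
        (Ideal.mul_mem_right _ _ (Ideal.mem_span_singleton_self _)))

theorem submonomial (m : ((i : Fin n) × Fin (a i + 1)) →₀ ℕ) (i : Fin n) (B : ℕ)
    (hB : B ≤ Finsupp.weight (coxWeight n a) m i) :
    ∃ m' m'', m = m' + m'' ∧ Finsupp.weight (coxWeight n a) m' = Pi.single i B := by
  classical
  induction B with
  | zero => exact ⟨0, m, by simp, by simp⟩
  | succ B ih =>
    obtain ⟨m', m'', rfl, h⟩ := ih (by omega)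
    rw [map_add, Pi.add_apply, h, Pi.single_eq_same] at hB
    have : ∃ j, m'' ⟨i, j⟩ ≠ 0 := by
      by_contra hcon
      push Not at hcon
      rw [weight_cox, Finset.sum_eq_zero (fun j _ => hcon j)] at hB
      omega
    obtain ⟨j, hj⟩ := this
    refine ⟨m' + Finsupp.single ⟨i, j⟩ 1, m'' - Finsupp.single ⟨i, j⟩ 1, ?_, ?_⟩
    · rw [add_assoc, add_tsub_cancel_of_le]
      rw [Finsupp.single_le_iff]
      omega
    · rw [map_add, h, Finsupp.weight_single, one_smul, coxWeight, ← Pi.single_add]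

theorem piece_one_mul (hb : ∀ i, 0 < b i) {J : Ideal (MvPolynomial ((i : Fin n) × Fin (a i + 1)) k)}
    {p : MvPolynomial ((i : Fin n) × Fin (a i + 1)) k}
    (h : ∀ g, IsWeightedHomogeneous (wt a b) g (1 • eta b) → g * p ∈ J)
    {q : MvPolynomial ((i : Fin n) × Fin (a i + 1)) k} (hq : A0 b q) (hq0 : coeff 0 q = 0) :
    q * p ∈ J := by
  classical
  rw [q.as_sum, Finset.sum_mul]
  refine Ideal.sum_mem _ fun m hm => ?_
  have hm' := mem_support_iff.1 hm
  have hdiv := A0_monomial.2 (hq hm')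
  have hne : m ≠ 0 := by rintro rfl; exact hm' hq0
  obtain ⟨⟨i, j⟩, hij⟩ := Finsupp.ne_iff.1 hne
  have hpos : 0 < Finsupp.weight (coxWeight n a) m i := by
    rw [weight_cox]
    exact Finset.sum_pos' (fun _ _ => Nat.zero_le _) ⟨j, Finset.mem_univ _, Nat.pos_of_ne_zero hij⟩
  obtain ⟨m', m'', rfl, hw⟩ := submonomial m i (b i) (Nat.le_of_dvd hpos (hdiv i))
  have e : monomial (m' + m'') (coeff (m' + m'') q) =
      monomial m'' (coeff (m' + m'') q) * monomial m' 1 := by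
    rw [monomial_mul, mul_one, add_comm]
  rw [e, mul_assoc]
  apply J.mul_mem_left
  apply h
  apply isWeightedHomogeneous_monomial
  rw [weight_wt, hw, phi_single b hb, one_smul]

end veronese

theorem reg_iff {R : Type} [CommRing R] (K : Ideal R) (r : R) :
    IsSMulRegular (R ⧸ (K • ⊤ : Submodule R R)) r ↔ RegMod K r := by
  rw [isSMulRegular_quotient_iff_mem_of_smul_mem]
  simp only [smul_eq_mul, Ideal.mul_top]
  rfl


theorem main_aux {k : Type} [Field k] {n : ℕ} {a b : Fin n → ℕ} (hb : ∀ i, 0 < b i)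
    {I : Ideal (MvPolynomial ((i : Fin n) × Fin (a i + 1)) k)} (hI : HomI (wG a b) I)
    (T : List (MvPolynomial ((i : Fin n) × Fin (a i + 1)) k × ℕ))
    (hT : ∀ t ∈ T, IsWeightedHomogeneous (wt a b) t.1 (t.2 • eta b))
    (hreg : ∀ i (h : i < T.length),
      RegMod (I ⊔ Ideal.ofList ((T.map Prod.fst).take i)) (T[i]).1)
    (hone : 1 ∉ I ⊔ Ideal.ofList (T.map Prod.fst))
    (hfin : Module.Finite k (MvPolynomial ((i : Fin n) × Fin (a i + 1)) k ⧸
      (I ⊔ Ideal.ofList (T.map Prod.fst))))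
    (hpow : ∀ l, ∃ e : ℕ, X l ^ e ∈ I ⊔ Ideal.ofList (T.map Prod.fst))
    (hsoc : SocOne (wt a b) (I ⊔ Ideal.ofList (T.map Prod.fst)) ((T.map Prod.snd).sum • eta b)) :
    TbGorensteinWithA I b 0 := by
  classical
  set J := I ⊔ Ideal.ofList (T.map Prod.fst) with hJ
  have hT0 : ∀ t ∈ T.map Prod.fst, A0 b t := by
    intro t ht
    obtain ⟨u, hu, rfl⟩ := List.mem_map.1 ht
    exact A0_of_wt (hT u hu)
  have hJG : HomI (wG a b) J := homI_ofList hI hT0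
  have hkey : ∀ {p}, A0 b p → (toTb I b p ∈ Ideal.ofList ((T.map Prod.fst).map (toTb I b)) ↔ p ∈ J) :=
    fun hp => key hI hT0 hp
  set θ : Fin T.length → Tb I b := fun j => toTb I b (T[(j : ℕ)]).1 with hθ
  have hofn : List.ofFn θ = (T.map Prod.fst).map (toTb I b) := by
    apply List.ext_getElem
    · simp
    · intro i h1 h2
      simp [hθ]
  have hspan : Ideal.span (Set.range θ) = Ideal.ofList ((T.map Prod.fst).map (toTb I b)) := by
    rw [← hofn, Ideal.ofList]
    congr 1
    ext x
    simp [List.mem_ofFn]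
  refine ⟨T.length, θ, fun j => (T[(j : ℕ)]).2, ?_, ?_, ?_, ?_⟩
  · intro j
    have h1 := hT T[(j : ℕ)] (List.getElem_mem _)
    rw [hθ, toTb_val I (A0_of_wt h1)]
    exact mk_mem_piece I b hb h1
  · rw [hofn]
    refine ⟨⟨fun i hi => ?_⟩, ?_⟩
    · rw [reg_iff]
      simp only [List.length_map] at hi
      rw [← List.map_take]
      simp only [List.getElem_map]
      intro y hy
      obtain ⟨p, hp, rfl⟩ := exists_toTb I y
      have hz : A0 b (T[i]).1 := A0_of_wt (hT T[i] (List.getElem_mem _))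
      have hT1 : ∀ t ∈ (T.map Prod.fst).take i, A0 b t := fun t ht => hT0 t (List.mem_of_mem_take ht)
      rw [← toTb_mul I hz hp, key hI hT1 (by simpa using hz.mul hp)] at hy
      rw [key hI hT1 hp]
      exact hreg i hi _ hy
    · rw [smul_eq_mul, Ideal.mul_top]
      intro h
      apply hone
      have h1 : A0 b (1 : MvPolynomial ((i : Fin n) × Fin (a i + 1)) k) :=
        isWeightedHomogeneous_one _ _
      rw [← hkey h1, ← h]
      trivial
  · rw [hspan]
    let φ : Tb I b →ₐ[k] (MvPolynomial ((i : Fin n) × Fin (a i + 1)) k ⧸ J) :=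
      (Ideal.Quotient.factorₐ k (le_sup_left : I ≤ J)).comp (Tb I b).val
    have hφ : ∀ {p}, A0 b p → φ (toTb I b p) = Ideal.Quotient.mk J p := by
      intro p hp
      change Ideal.Quotient.factorₐ k (le_sup_left : I ≤ J) (toTb I b p : _ ⧸ I) = _
      rw [toTb_val I hp]
      rfl
    have hker : ∀ y, φ y = 0 ↔ y ∈ Ideal.ofList ((T.map Prod.fst).map (toTb I b)) := by
      intro y
      obtain ⟨p, hp, rfl⟩ := exists_toTb I y
      rw [hφ hp, hkey hp, Ideal.Quotient.eq_zero_iff_mem]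
    let ψ := Ideal.Quotient.liftₐ (Ideal.ofList ((T.map Prod.fst).map (toTb I b))) φ
      (fun y hy => (hker y).2 hy)
    have hψ : Function.Injective ψ := by
      rw [injective_iff_map_eq_zero]
      intro x hx
      obtain ⟨y, rfl⟩ := Ideal.Quotient.mk_surjective x
      exact Ideal.Quotient.eq_zero_iff_mem.2 ((hker y).1 hx)
    exact FiniteDimensional.of_injective ψ.toLinearMap hψ
  · obtain ⟨s, hs, hsJ, hsX, hsU⟩ := hsoc
    have hsA : A0 b s := A0_of_wt hs
    refine ⟨(T.map Prod.snd).sum, Ideal.Quotient.mk _ (toTb I b s), ?_, ?_, ?_, ?_⟩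
    · rw [add_zero, ← Nat.cast_sum, ← List.sum_ofFn]
      congr 2
      apply List.ext_getElem
      · simp
      · intro i h1 h2
        simp
    · rw [Ne, Ideal.Quotient.eq_zero_iff_mem, hspan, hkey hsA]
      exact hsJ
    · refine ⟨toTb I b s, ?_, rfl⟩
      rw [toTb_val I hsA]
      exact mk_mem_piece I b hb hs
    · intro x hx
      obtain ⟨y, rfl⟩ := Ideal.Quotient.mk_surjective x
      obtain ⟨p, hp, rfl⟩ := exists_toTb I y
      have hg : ∀ g, IsWeightedHomogeneous (wt a b) g (1 • eta b) → g * p ∈ J := by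
        intro g hg
        have hgA := A0_of_wt hg
        have h1 := hx (toTb I b g) (by rw [toTb_val I hgA]; exact mk_mem_piece I b hb hg)
        rw [← map_mul, Ideal.Quotient.eq_zero_iff_mem, hspan, ← toTb_mul I hgA hp,
          hkey (by simpa using hgA.mul hp)] at h1
        exact h1
      have main : ∃ d : k, p - C d * s ∈ J := by
        by_cases hpJ : p ∈ J
        · exact ⟨0, by simpa using hpJ⟩
        obtain ⟨q, hq, hqX⟩ := essential hpow hpJ
        obtain ⟨d, hd⟩ := hsU _ hqX
        have hd0 : d ≠ 0 := by
          rintro rfl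
          apply hq
          simpa using hd
        have h1 := hJG _ hd 0
        set q0 := weightedHomogeneousComponent (wG a b) 0 q with hq0
        have hq0A : A0 b q0 := weightedHomogeneousComponent_isWeightedHomogeneous _ _
        have e := comp_mul hp q 0
        rw [add_zero] at e
        rw [map_sub, mul_comm q p, e, (hsA.C_mul d).weightedHomogeneousComponent_same] at h1
        set r := coeff 0 q0 with hr
        have h2 : (q0 - C r) * p ∈ J := by
          refine piece_one_mul hb hg (hq0A.sub (isWeightedHomogeneous_C _ _)) ?_
          simp [hr]
        have h3 : C r * p - C d * s ∈ J := by
          have := J.sub_mem h1 h2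
          convert this using 1
          ring
        have hr0 : r ≠ 0 := by
          intro hr0
          rw [hr0] at h3
          apply hsJ
          have := J.mul_mem_left (C (-d⁻¹)) h3
          rw [map_zero, zero_mul, zero_sub, mul_neg, ← mul_assoc, ← C_mul, neg_mul,
            inv_mul_cancel₀ hd0] at this
          simpa using this
        refine ⟨r⁻¹ * d, ?_⟩
        have := J.mul_mem_left (C r⁻¹) h3
        rw [mul_sub, ← mul_assoc, ← C_mul, inv_mul_cancel₀ hr0, ← mul_assoc, ← C_mul] at this
        simpa using this
      obtain ⟨d, hd⟩ := main
      refine ⟨d, ?_⟩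
      have hds := hsA.C_mul d
      have e1 : toTb I b p = toTb I b (p - C d * s) + d • toTb I b s := by
        rw [← toTb_smul I hsA, ← toTb_add I (hp.sub hds) hds, sub_add_cancel]
      have e2 : Ideal.Quotient.mk (Ideal.span (Set.range θ)) (toTb I b (p - C d * s)) = 0 := by
        rw [Ideal.Quotient.eq_zero_iff_mem, hspan, hkey (hp.sub hds)]
        exact hd
      rw [e1, map_add, e2, zero_add]
      rfl

end CYaux

theorem complete_intersection_CalabiYau {k : Type} [Field k] {n : ℕ} (hn : 0 < n)
    (a : Fin n → ℕ) (b : Fin n → ℕ) (hb : ∀ i, 0 < b i)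
    (c : ℕ) (f : Fin c → MvPolynomial ((i : Fin n) × Fin (a i + 1)) k)
    (δ : Fin c → (Fin n → ℕ))
    (hhom : ∀ j, f j ∈ weightedHomogeneousSubmodule k (coxWeight n a) (δ j))
    (hreg : RingTheory.Sequence.IsRegular
      (MvPolynomial ((i : Fin n) × Fin (a i + 1)) k) (List.ofFn f))
    (hdeg : ∀ i, (∑ j, δ j i) = a i + 1) :
    TbGorensteinWithA (Ideal.span (Set.range f)) b 0 := by
  classical
  have hη : ∀ l, ∃ e : ℕ, 0 < e ∧ e • CYaux.wt a b l = CYaux.eta b := by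
    rintro ⟨i, j⟩
    refine ⟨b i, hb i, ?_⟩
    rw [CYaux.wt, ← map_nsmul, coxWeight, ← CYaux.phi_single b hb i]
    congr 1
    rw [← Pi.single_smul, smul_eq_mul, mul_one]
  have hη0 : ∀ d : ℕ, 0 < d → d • CYaux.eta b ≠ 0 := by
    intro d hd h
    rw [CYaux.eta_smul] at h
    have := congrArg Prod.snd h
    simp at this
    omega
  have hcoxhom : ∀ j, IsWeightedHomogeneous (coxWeight n a) (f j) (δ j) := hhom
  have hne : (1 : MvPolynomial ((i : Fin n) × Fin (a i + 1)) k) ∉ Ideal.ofList (List.ofFn f) := by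
    intro h
    apply hreg.top_ne_smul
    rw [smul_eq_mul, Ideal.mul_top, (Ideal.eq_top_iff_one _).2 h]
  have hfmm : ∀ j, f j ∈ CYaux.mm k ((i : Fin n) × Fin (a i + 1)) := by
    intro j
    apply CYaux.mm_of_coeff
    by_contra h0
    have hδ : δ j = 0 := by simpa using (hcoxhom j h0).symm
    have hC : f j = C (coeff 0 (f j)) := by
      ext m
      rw [coeff_C]
      split_ifs with hm
      · rw [hm]
      · by_contra hm0
        apply hm
        have h1 := hcoxhom j hm0
        ext ⟨i, l⟩
        have h2 := congrFun h1 i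
        rw [CYaux.weight_cox, hδ, Pi.zero_apply, Finset.sum_eq_zero_iff] at h2
        exact (h2 l (Finset.mem_univ _)).symm
    apply hne
    have h3 : f j ∈ Ideal.ofList (List.ofFn f) := Ideal.subset_span (by simp [List.mem_ofFn])
    have h4 := Ideal.mul_mem_left _ (C (coeff 0 (f j))⁻¹) h3
    rw [hC, ← C_mul, coeff_C, if_pos rfl, inv_mul_cancel₀ h0, C_1] at h4
    exact h4
  set G : List (MvPolynomial ((i : Fin n) × Fin (a i + 1)) k × ((∀ i, ZMod (b i)) × ℚ)) :=
    List.ofFn (fun j => (f j, CYaux.phi b (δ j))) with hG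
  have hGf : G.map Prod.fst = List.ofFn f := by
    rw [hG, List.map_ofFn]
    rfl
  have hGd : (G.map Prod.snd).sum = ∑ l, CYaux.wt a b l := by
    rw [hG, List.map_ofFn, List.sum_ofFn]
    simp only [Function.comp, CYaux.wt]
    rw [← map_sum, ← map_sum]
    congr 1
    ext i
    rw [Finset.sum_apply, hdeg, Finset.sum_apply, Fintype.sum_sigma, Finset.sum_eq_single i]
    · simp [coxWeight]
    · intro i' _ hi
      simp [coxWeight, hi.symm]
    · simp
  have hGgood : ∀ g ∈ G, CYaux.Good (CYaux.wt a b) g := by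
    intro g hg
    rw [hG, List.mem_ofFn] at hg
    obtain ⟨j, rfl⟩ := hg
    exact ⟨CYaux.hom_wt_of_cox (hcoxhom j), hfmm j⟩
  have hGreg : CYaux.RegSeq ⊥ G := by
    rw [CYaux.regSeq_iff]
    intro i hi
    have hi' : i < (List.ofFn f).length := by simpa [hG] using hi
    have h1 := hreg.regular_mod_prev i hi'
    rw [CYaux.reg_iff] at h1
    rw [CYaux.extI_eq, bot_sup_eq, List.map_take, hGf]
    simpa [hG] using h1
  have hGI : CYaux.extI ⊥ G = Ideal.span (Set.range f) := by
    rw [CYaux.extI_eq, bot_sup_eq, hGf, Ideal.ofList]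
    congr 1
    ext x
    simp [List.mem_ofFn]
  have hlen := CYaux.reg_length_le _ hGgood hGreg
  rw [Nat.card_eq_fintype_card] at hlen
  obtain ⟨T, hTl, hT, hTreg⟩ := CYaux.exists_ext _ hη hη0
    (Fintype.card ((i : Fin n) × Fin (a i + 1)) - G.length) hGgood hGreg (by omega)
  set T' := T.map (fun t => (t.1, t.2 • CYaux.eta b)) with hT'
  have hT'f : T'.map Prod.fst = T.map Prod.fst := by
    rw [hT', List.map_map]
    rfl
  have hT's : (T'.map Prod.snd).sum = (T.map Prod.snd).sum • CYaux.eta b := by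
    rw [hT', List.map_map, List.sum_smul, List.map_map]
    rfl
  have hfull : ∀ g ∈ G ++ T', CYaux.Good (CYaux.wt a b) g := by
    intro g hg
    rcases List.mem_append.1 hg with hg | hg
    · exact hGgood g hg
    · obtain ⟨t, ht, rfl⟩ := List.mem_map.1 hg
      exact ⟨(hT t ht).1, CYaux.hom_mm _ (hT t ht).1 (hη0 _ (hT t ht).2)⟩
  have hflen : (G ++ T').length = Fintype.card ((i : Fin n) × Fin (a i + 1)) := by
    rw [List.length_append, hT', List.length_map]
    omega
  have hJ : CYaux.extI ⊥ (G ++ T') = Ideal.span (Set.range f) ⊔ Ideal.ofList (T.map Prod.fst) := by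
    rw [CYaux.extI_append, hGI, CYaux.extI_eq, hT'f]
  have hfin := CYaux.reg_finite hTreg (by rw [hflen, Nat.card_eq_fintype_card])
  have hsoc := CYaux.socOne_of_eq _ hη hη0 hfull hTreg hflen
  have hmm := CYaux.extI_le_mm _ hfull
  have hpow := CYaux.X_pow_mem _ hη hη0 (CYaux.extI_hom _ (CYaux.HomI.bot _) hfull) hfin
  rw [List.map_append, List.sum_append, hGd, neg_add_cancel_left, hT's] at hsoc
  rw [hJ] at hfin hsoc hmm hpow
  refine CYaux.main_aux hb ?_ T (fun t ht => (hT t ht).1) ?_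
    (fun h => CYaux.one_notMem_mm (hmm h)) hfin hpow hsoc
  · have hGw : ∀ g ∈ G.map (fun g => (g.1, g.2.1)), CYaux.Good (CYaux.wG a b) g := by
      intro g hg
      obtain ⟨g', hg', rfl⟩ := List.mem_map.1 hg
      exact ⟨CYaux.hom_wG_of_wt (hGgood g' hg').1, (hGgood g' hg').2⟩
    have h1 := CYaux.extI_hom _ (CYaux.HomI.bot _) hGw
    rw [CYaux.extI_eq, List.map_map] at h1
    rw [← hGI, CYaux.extI_eq]
    exact h1
  · intro i hi
    have h1 := ((CYaux.regSeq_append _ _ _).1 hTreg).2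
    rw [hGI, CYaux.regSeq_iff] at h1
    have h2 := h1 i (by simpa [hT'] using hi)
    rw [CYaux.extI_eq, List.map_take, hT'f] at h2
    simpa [hT'] using h2

end
end

section
/- Let Z ⊆ P^{a_1} × ... × P^{a_n} be a divisor of multidegree (d_1,...,d_n). Then for b ∈ ℕ_+^n, the degree of the correspondence scroll C(Z;b) ⊆ P^N equals Σ_{i=1}^n d_i · b_i^{a_i − 1} · Π_{j ≠ i} b_j^{a_j}. -/
open MvPolynomial

noncomputable section

/-- The Hilbert function of the standard graded ring `T_b(A/I)`, the homogeneous
coordinate ring of `C(Z;b)`. -/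
def hilbTb {k : Type} [Field k] {n : ℕ} {a : Fin n → ℕ}
    (I : Ideal (MvPolynomial ((i : Fin n) × Fin (a i + 1)) k)) (b : Fin n → ℕ)
    (s : ℕ) : ℕ :=
  Module.finrank k
    ↥(⨆ t ∈ Finset.Nat.antidiagonalTuple n s, quotComponent I (fun i => b i * t i))

/-- `h` is eventually given by a polynomial of degree `D` whose leading coefficient,
normalized by `D!`, is `e`; i.e. the corresponding projective scheme has dimension
`D` and degree `e`. -/
def HasDegreeDim (h : ℕ → ℕ) (D : ℕ) (e : ℚ) : Prop :=
  ∃ P : Polynomial ℚ, (∃ s₀, ∀ s ≥ s₀, (h s : ℚ) = P.eval (s : ℚ)) ∧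
    P.natDegree = D ∧ P.leadingCoeff * (Nat.factorial D) = e

/-- Rationality predicate: `(1-X)^m * Σ u(t) X^t` is a polynomial with value `c` at `1`. -/
def RatSer (u : ℕ → ℚ) (m : ℕ) (c : ℚ) : Prop :=
  ∃ g : Polynomial ℚ, (1 - PowerSeries.X) ^ m * PowerSeries.mk u = (g : PowerSeries ℚ) ∧
    g.eval 1 = c

lemma RatSer.add {u v : ℕ → ℚ} {m : ℕ} {c c' : ℚ} (hu : RatSer u m c) (hv : RatSer v m c') :
    RatSer (fun t => u t + v t) m (c + c') := by
  obtain ⟨g, hg, rfl⟩ := hu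
  obtain ⟨g', hg', rfl⟩ := hv
  refine ⟨g + g', ?_, by simp⟩
  have : PowerSeries.mk (fun t => u t + v t) = PowerSeries.mk u + PowerSeries.mk v := by
    ext; simp
  rw [this, mul_add, hg, hg', Polynomial.coe_add]

lemma RatSer.zero (m : ℕ) : RatSer (fun _ => 0) m 0 := by
  refine ⟨0, ?_, by simp⟩
  have : PowerSeries.mk (fun _ => (0 : ℚ)) = 0 := by ext; simp
  rw [this]; simp

lemma RatSer.sum {ι : Type} (s : Finset ι) {u : ι → ℕ → ℚ} {m : ℕ} {c : ι → ℚ}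
    (h : ∀ i ∈ s, RatSer (u i) m (c i)) : RatSer (fun t => ∑ i ∈ s, u i t) m (∑ i ∈ s, c i) := by
  classical
  induction s using Finset.induction_on with
  | empty => simpa using RatSer.zero m
  | insert i s hi ih =>
    simp only [Finset.sum_insert hi]
    exact (h i (by simp)).add (ih fun j hj => h j (by simp [hj]))

lemma RatSer.congr {u v : ℕ → ℚ} {m : ℕ} {c : ℚ} (hu : RatSer u (m + 1) c) (s₀ : ℕ)
    (h : ∀ s ≥ s₀, v s = u s) : RatSer v (m + 1) c := by
  obtain ⟨g, hg, rfl⟩ := hu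
  let r : Polynomial ℚ := PowerSeries.trunc s₀ (PowerSeries.mk fun t => v t - u t)
  have : PowerSeries.mk v = PowerSeries.mk u + (r : PowerSeries ℚ) := by
    ext t
    simp only [PowerSeries.coeff_mk, map_add, Polynomial.coeff_coe, r, PowerSeries.coeff_trunc]
    split_ifs with ht
    · ring
    · rw [h t (by omega)]; ring
  refine ⟨g + (1 - Polynomial.X) ^ (m + 1) * r, ?_, by simp⟩
  rw [this, mul_add, hg]
  simp

lemma RatSer.poly (m : ℕ) : ∀ P : Polynomial ℚ, P.natDegree ≤ m →
    RatSer (fun t => P.eval (t : ℚ)) (m + 1) (m.factorial * P.coeff m) := by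
  have key : ∀ m : ℕ, ∀ c : ℚ, (1 - PowerSeries.X) ^ (m + 1) *
      PowerSeries.mk (fun t : ℕ => c * (Polynomial.preHilbertPoly ℚ m 0).eval (t : ℚ)) =
      PowerSeries.C c := by
    intro m c
    have h1 : PowerSeries.mk (fun t : ℕ => c * (Polynomial.preHilbertPoly ℚ m 0).eval (t : ℚ)) =
      PowerSeries.C c * (PowerSeries.invOneSubPow ℚ (m + 1)).val := by
      ext t
      rw [PowerSeries.coeff_mk, PowerSeries.coeff_C_mul,
        PowerSeries.invOneSubPow_val_succ_eq_mk_add_choose, PowerSeries.coeff_mk,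
        Polynomial.preHilbertPoly_eq_choose_sub_add ℚ m (Nat.zero_le t), Nat.sub_zero, add_comm]
    rw [h1, mul_left_comm, ← PowerSeries.invOneSubPow_inv_eq_one_sub_pow, Units.inv_eq_val_inv,
      Units.inv_mul, mul_one]
  induction m with
  | zero =>
    intro P hP
    refine ⟨Polynomial.C (P.coeff 0), ?_, by simp⟩
    rw [Polynomial.coe_C, ← key 0]
    congr 2
    ext t
    rw [Polynomial.eq_C_of_natDegree_le_zero hP]
    simp [Polynomial.preHilbertPoly]
  | succ m ih =>
    intro P hP
    set c : ℚ := (m + 1).factorial * P.coeff (m + 1) with hc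
    set H := Polynomial.preHilbertPoly ℚ (m + 1) 0 with hH
    have hne : ((m + 1).factorial : ℚ) ≠ 0 := by positivity
    have hco : (P - Polynomial.C c * H).coeff (m + 1) = 0 := by
      rw [Polynomial.coeff_sub, Polynomial.coeff_C_mul, hH, Polynomial.coeff_preHilbertPoly_self,
        hc]
      field_simp; ring
    have hdeg : (P - Polynomial.C c * H).natDegree ≤ m := by
      rw [Polynomial.natDegree_le_iff_coeff_eq_zero]
      intro N hN
      rcases Nat.lt_or_ge (m + 1) N with h | h
      · apply Polynomial.coeff_eq_zero_of_natDegree_lt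
        refine lt_of_le_of_lt (Polynomial.natDegree_sub_le _ _) (max_lt (by omega) ?_)
        refine lt_of_le_of_lt (Polynomial.natDegree_C_mul_le _ _) ?_
        rw [hH, Polynomial.natDegree_preHilbertPoly]; exact h
      · obtain rfl : N = m + 1 := by omega
        exact hco
    obtain ⟨g, hg, -⟩ := ih _ hdeg
    refine ⟨(1 - Polynomial.X) * g + Polynomial.C c, ?_, by simp⟩
    have : PowerSeries.mk (fun t : ℕ => P.eval (t : ℚ)) =
      PowerSeries.mk (fun t : ℕ => (P - Polynomial.C c * H).eval (t : ℚ)) +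
      PowerSeries.mk (fun t : ℕ => c * H.eval (t : ℚ)) := by
      ext t; simp
    rw [this, mul_add, key, pow_succ', mul_assoc, hg]
    simp

lemma RatSer.choose (a k b : ℕ) (hb : 0 < b) (v : ℕ → ℚ)
    (hv : ∀ t, k ≤ b * t → v t = ((b * t - k + a).choose a : ℕ)) :
    RatSer v (a + 1) ((b : ℚ) ^ a) := by
  have hd : ((Polynomial.preHilbertPoly ℚ a k).comp (Polynomial.C (b : ℚ) * Polynomial.X)).natDegree
      ≤ a := by
    refine Polynomial.natDegree_comp_le.trans ?_
    rw [Polynomial.natDegree_preHilbertPoly]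
    have h1 : (Polynomial.C (b : ℚ) * Polynomial.X).natDegree ≤ 1 :=
      (Polynomial.natDegree_C_mul_le _ _).trans Polynomial.natDegree_X_le
    calc _ ≤ a * 1 := Nat.mul_le_mul_left a h1
      _ = a := mul_one a
  have h := RatSer.poly a _ hd
  have hc : (a.factorial : ℚ) * ((Polynomial.preHilbertPoly ℚ a k).comp
      (Polynomial.C (b : ℚ) * Polynomial.X)).coeff a = (b : ℚ) ^ a := by
    rw [Polynomial.comp_C_mul_X_coeff, Polynomial.coeff_preHilbertPoly_self]
    have hne : (a.factorial : ℚ) ≠ 0 := by positivity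
    field_simp
  rw [hc] at h
  refine h.congr k fun s hs => ?_
  have hks : k ≤ b * s := hs.le.trans (Nat.le_mul_of_pos_left s hb)
  rw [hv s hks]
  have := Polynomial.preHilbertPoly_eq_choose_sub_add ℚ a hks
  simp only [Polynomial.eval_comp, Polynomial.eval_mul, Polynomial.eval_C, Polynomial.eval_X]
  rw [← this]; push_cast; rfl

lemma choose_tele (a N : ℕ) (d : ℕ) (h : d ≤ N) :
    (N + (a + 1)).choose (a + 1) = (N - d + (a + 1)).choose (a + 1) +
      ∑ k ∈ Finset.range d, (N - k + a).choose a := by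
  induction d with
  | zero => simp
  | succ d ih =>
    rw [ih (by omega), Finset.sum_range_succ]
    obtain ⟨M, hM⟩ : ∃ M, N - d = M + 1 := ⟨N - d - 1, by omega⟩
    have h2 : N - (d + 1) = M := by omega
    rw [hM, h2]
    have : (M + 1 + (a + 1)).choose (a + 1) = (M + 1 + a).choose a + (M + 1 + a).choose (a + 1) := by
      rw [← add_assoc, Nat.choose_succ_succ]
    rw [this, show M + (a + 1) = M + 1 + a by ring]; ring

/-- one-variable counting function -/
def cnt (a b d t : ℕ) : ℕ := if d ≤ b * t then (b * t - d + a).choose a else 0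

lemma ratSer_cnt (a b d : ℕ) (hb : 0 < b) :
    RatSer (fun t => (cnt a b d t : ℚ)) (a + 1) ((b : ℚ) ^ a) := by
  refine RatSer.choose a d b hb _ fun t ht => ?_
  simp [cnt, ht]

lemma ratSer_cnt_sub (a b d : ℕ) (hb : 0 < b) (ha : 0 < a) :
    RatSer (fun t => (cnt a b 0 t : ℚ) - cnt a b d t) a (d * (b : ℚ) ^ (a - 1)) := by
  obtain ⟨a, rfl⟩ : ∃ a', a = a' + 1 := ⟨a - 1, by omega⟩
  have h := RatSer.sum (Finset.range d)
    (u := fun k t => ((b * t - k + a).choose a : ℚ)) (m := a + 1) (c := fun _ => (b : ℚ) ^ a)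
    (fun k _ => RatSer.choose a k b hb _ fun t ht => rfl)
  simp only [Finset.sum_const, Finset.card_range, nsmul_eq_mul] at h
  refine h.congr d fun t ht => ?_
  have hks : d ≤ b * t := ht.le.trans (Nat.le_mul_of_pos_left t hb)
  have := choose_tele a (b * t) d hks
  simp only [cnt, hks, Nat.zero_le, if_true, Nat.sub_zero]
  rw [this]; push_cast; ring

lemma prod_sub_poly {ι : Type} [DecidableEq ι] (s : Finset ι) (p q g : ι → Polynomial ℚ)
    (c : ι → ℚ) (hp : ∀ i, (p i).eval 1 = c i) (hq : ∀ i, (q i).eval 1 = c i)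
    (h : ∀ i, p i - q i = (1 - Polynomial.X) * g i) :
    ∃ G, (∏ i ∈ s, p i - ∏ i ∈ s, q i) = (1 - Polynomial.X) * G ∧
      G.eval 1 = ∑ i ∈ s, (g i).eval 1 * ∏ j ∈ s.erase i, c j := by
  induction s using Finset.induction_on with
  | empty => exact ⟨0, by simp, by simp⟩
  | insert i s hi ih =>
    obtain ⟨G, hG, hG1⟩ := ih
    refine ⟨g i * ∏ j ∈ s, p j + q i * G, ?_, ?_⟩
    · rw [Finset.prod_insert hi, Finset.prod_insert hi]
      linear_combination (∏ j ∈ s, p j) * h i + q i * hG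
    · rw [Finset.sum_insert hi, Finset.erase_insert hi, Polynomial.eval_add, Polynomial.eval_mul,
        Polynomial.eval_mul, hG1, hq, Polynomial.eval_prod, Finset.mul_sum]
      congr 1
      · simp [hp]
      · refine Finset.sum_congr rfl fun j hj => ?_
        have hij : i ≠ j := fun e => hi (e ▸ hj)
        rw [Finset.erase_insert_of_ne hij, Finset.prod_insert (by simp [hi])]
        ring

lemma ratSer_hasDegreeDim (h : ℕ → ℕ) (D : ℕ) (e : ℚ) (he : e ≠ 0)
    (H : RatSer (fun s => (h s : ℚ)) (D + 1) e) : 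
    ∃ P : Polynomial ℚ, (∃ s₀, ∀ s ≥ s₀, (h s : ℚ) = P.eval (s : ℚ)) ∧
    P.natDegree = D ∧ P.leadingCoeff * (Nat.factorial D) = e := by
  obtain ⟨g, hg, rfl⟩ := H
  have hne : (D.factorial : ℚ) ≠ 0 := by positivity
  have hco : (Polynomial.hilbertPoly g (D + 1)).coeff D * D.factorial = g.eval 1 := by
    rw [Polynomial.hilbertPoly_succ, Polynomial.finsetSum_coeff, Finset.sum_mul,
      Polynomial.eval_eq_sum, Polynomial.sum_def]
    refine Finset.sum_congr rfl fun i _ => ?_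
    rw [Polynomial.coeff_smul, Polynomial.coeff_preHilbertPoly_self]
    simp [hne]
  have hnd : (Polynomial.hilbertPoly g (D + 1)).natDegree = D := by
    apply Polynomial.natDegree_eq_of_le_of_coeff_ne_zero
    · rw [Polynomial.hilbertPoly_succ]
      apply Polynomial.natDegree_sum_le_of_forall_le _ _ fun _ _ => ?_
      apply le_trans (Polynomial.natDegree_smul_le _ _)
      rw [Polynomial.natDegree_preHilbertPoly]
    · intro h0
      rw [h0, zero_mul] at hco
      exact he hco.symm
  refine ⟨Polynomial.hilbertPoly g (D + 1), ⟨g.natDegree + 1, fun s hs => ?_⟩, hnd, ?_⟩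
  · rw [← Polynomial.coeff_mul_invOneSubPow_eq_hilbertPoly_eval (D + 1) hs, ← hg,
      ← PowerSeries.invOneSubPow_inv_eq_one_sub_pow, Units.inv_eq_val_inv, mul_comm, ← mul_assoc,
      Units.mul_inv, one_mul, PowerSeries.coeff_mk]
  · rw [Polynomial.leadingCoeff, hnd, hco]

lemma coeff_prod_mk (n s : ℕ) (u : Fin n → ℕ → ℚ) :
    PowerSeries.coeff s (∏ i, PowerSeries.mk (u i)) =
      ∑ t ∈ Finset.Nat.antidiagonalTuple n s, ∏ i, u i (t i) := by
  rw [PowerSeries.coeff_prod]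
  simp only [PowerSeries.coeff_mk]
  refine Finset.sum_bij (fun t _ => ⇑t) ?_ ?_ ?_ ?_
  · intro t ht
    simpa [Finset.Nat.mem_antidiagonalTuple] using ht
  · intro t _ t' _ h
    exact DFunLike.coe_injective h
  · intro t ht
    exact ⟨Finsupp.equivFunOnFinite.symm t,
      by simpa [Finset.Nat.mem_antidiagonalTuple] using ht, by simp⟩
  · intros; rfl

lemma ratSer_main {n : ℕ} (hn : 0 < n) (a : Fin n → ℕ) (ha : ∀ i, 0 < a i)
    (b : Fin n → ℕ) (hb : ∀ i, 0 < b i) (d : Fin n → ℕ) :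
    RatSer (fun s => (∑ t ∈ Finset.Nat.antidiagonalTuple n s, ∏ i, (cnt (a i) (b i) 0 (t i) : ℚ)) -
      ∑ t ∈ Finset.Nat.antidiagonalTuple n s, ∏ i, (cnt (a i) (b i) (d i) (t i) : ℚ))
      ((∑ i, a i) + n - 2 + 1) (∑ i, (d i : ℚ) * (b i : ℚ) ^ (a i - 1) *
        ∏ j ∈ Finset.univ.erase i, (b j : ℚ) ^ (a j)) := by
  choose p hp hp1 using fun i => ratSer_cnt (a i) (b i) 0 (hb i)
  choose q hq hq1 using fun i => ratSer_cnt (a i) (b i) (d i) (hb i)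
  choose g hg hg1 using fun i => ratSer_cnt_sub (a i) (b i) (d i) (hb i) (ha i)
  have hpq : ∀ i, p i - q i = (1 - Polynomial.X) * g i := by
    intro i
    apply Polynomial.coe_injective ℚ
    rw [Polynomial.coe_sub, ← hp, ← hq, Polynomial.coe_mul, ← hg, ← mul_sub, Polynomial.coe_sub,
      Polynomial.coe_one, Polynomial.coe_X, pow_succ', mul_assoc]
    congr 2
  obtain ⟨G, hG, hG1⟩ := prod_sub_poly Finset.univ p q g _ hp1 hq1 hpq
  refine ⟨G, ?_, by rw [hG1]; simp only [hg1]⟩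
  have hx : (1 - PowerSeries.X : PowerSeries ℚ) ≠ 0 := by
    intro h
    have := congrArg (PowerSeries.coeff 0) h
    simp at this
  have hlow : n ≤ ∑ i, a i := by
    have : ∑ i : Fin n, 1 ≤ ∑ i, a i := Finset.sum_le_sum fun i _ => ha i
    simpa using this
  apply mul_left_cancel₀ hx
  have e1 : (1 - PowerSeries.X : PowerSeries ℚ) * (G : PowerSeries ℚ) =
      ((∏ i, p i - ∏ i, q i : Polynomial ℚ) : PowerSeries ℚ) := by
    rw [hG]; simp
  have cp : ∀ p : Fin n → Polynomial ℚ, ((∏ i, p i : Polynomial ℚ) : PowerSeries ℚ) =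
      ∏ i, (p i : PowerSeries ℚ) := fun p => by
    simp only [← Polynomial.coeToPowerSeries.ringHom_apply, map_prod]
  have e2 : (PowerSeries.mk (fun s => (∑ t ∈ Finset.Nat.antidiagonalTuple n s, ∏ i, (cnt (a i) (b i) 0 (t i) : ℚ)) -
      ∑ t ∈ Finset.Nat.antidiagonalTuple n s, ∏ i, (cnt (a i) (b i) (d i) (t i) : ℚ))) =
      ∏ i, PowerSeries.mk (fun t => (cnt (a i) (b i) 0 t : ℚ)) -
      ∏ i, PowerSeries.mk (fun t => (cnt (a i) (b i) (d i) t : ℚ)) := by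
    ext s
    rw [map_sub, coeff_prod_mk, coeff_prod_mk, PowerSeries.coeff_mk]
  rw [e1, Polynomial.coe_sub, cp, cp, e2, ← mul_assoc, ← pow_succ']
  simp only [← hp, ← hq]
  rw [Finset.prod_mul_distrib, Finset.prod_mul_distrib, Finset.prod_pow_eq_pow_sum, ← mul_sub]
  congr 2
  rw [Finset.sum_add_distrib]; simp; omega

lemma card_one (a e d : ℕ) : Nat.card {x : Fin (a + 1) → ℕ // ∑ j, x j + d = e} =
    if d ≤ e then (e - d + a).choose a else 0 := by
  split_ifs with h
  · have E : {x : Fin (a + 1) → ℕ // ∑ j, x j + d = e} ≃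
        {x : Fin (a + 1) →₀ ℕ // x ∈ Finset.finsuppAntidiag Finset.univ (e - d)} :=
      Finsupp.equivFunOnFinite.symm.subtypeEquiv (fun x => by
        simp [Finset.mem_finsuppAntidiag]; omega)
    rw [Nat.card_congr E, Nat.card_eq_fintype_card, Fintype.card_coe,
      Finset.card_finsuppAntidiag_nat_eq_choose]
    rw [Finset.card_univ, Fintype.card_fin, show a + 1 + (e - d) - 1 = e - d + a by omega]
    rw [Nat.choose_symm_add]
  · have : IsEmpty {x : Fin (a + 1) → ℕ // ∑ j, x j + d = e} := ⟨fun x => by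
      have := x.2; omega⟩
    exact Nat.card_of_isEmpty

lemma weight_apply_cox {n : ℕ} (a : Fin n → ℕ) (m : ((i : Fin n) × Fin (a i + 1)) →₀ ℕ)
    (i : Fin n) : Finsupp.weight (coxWeight n a) m i = ∑ j, m ⟨i, j⟩ := by
  rw [Finsupp.weight_apply, Finsupp.sum_fintype _ _ (by simp), Finset.sum_apply,
    Fintype.sum_sigma, Finset.sum_eq_single i]
  · simp [coxWeight]
  · intro i' _ h
    simp [coxWeight, Pi.single_eq_of_ne h.symm]
  · simp

lemma card_weight {n : ℕ} (a e d : Fin n → ℕ) :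
    Nat.card {m : ((i : Fin n) × Fin (a i + 1)) →₀ ℕ //
      Finsupp.weight (coxWeight n a) m + d = e} =
    ∏ i, if d i ≤ e i then (e i - d i + a i).choose (a i) else 0 := by
  simp only [← card_one]
  rw [← Nat.card_pi]
  refine Nat.card_congr (Equiv.trans (Equiv.subtypeEquiv (p := fun m => Finsupp.weight (coxWeight n a) m + d = e)
    (q := fun x : (i : Fin n) → Fin (a i + 1) → ℕ => ∀ i, ∑ j, x i j + d i = e i)
    (Finsupp.equivFunOnFinite.trans (Equiv.piCurry (fun _ _ => ℕ))) ?_)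
    (Equiv.subtypePiEquivPi (p := fun i (x : Fin (a i + 1) → ℕ) => ∑ j, x j + d i = e i)))
  intro m
  rw [funext_iff]
  simp only [Pi.add_apply, weight_apply_cox]
  rfl

/-- monomials whose shifted weight lies in the list of degrees -/
def monSet {n : ℕ} (a b d : Fin n → ℕ) (s : ℕ) : Set (((i : Fin n) × Fin (a i + 1)) →₀ ℕ) :=
  {m | ∃ t ∈ Finset.Nat.antidiagonalTuple n s,
    Finsupp.weight (coxWeight n a) m + d = fun i => b i * t i}

lemma finite_weight {n : ℕ} (a e d : Fin n → ℕ) :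
    Set.Finite {m : ((i : Fin n) × Fin (a i + 1)) →₀ ℕ |
      Finsupp.weight (coxWeight n a) m + d = e} := by
  refine Set.Finite.subset (Set.finite_Iic
    (Finsupp.equivFunOnFinite.symm fun p : (i : Fin n) × Fin (a i + 1) => e p.1)) ?_
  intro m hm
  have hm : Finsupp.weight (coxWeight n a) m + d = e := hm
  intro p
  have h := congrFun hm p.1
  rw [Pi.add_apply, weight_apply_cox] at h
  have h2 : m ⟨p.1, p.2⟩ ≤ ∑ j, m ⟨p.1, j⟩ :=
    Finset.single_le_sum (f := fun j => m ⟨p.1, j⟩) (fun _ _ => Nat.zero_le _) (Finset.mem_univ p.2)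
  simp only [Finsupp.equivFunOnFinite_symm_apply_apply]
  exact h2.trans (by omega)

lemma monSet_eq {n : ℕ} (a b d : Fin n → ℕ) (s : ℕ) :
    monSet a b d s = ⋃ t ∈ (Finset.Nat.antidiagonalTuple n s : Set (Fin n → ℕ)),
      {m | Finsupp.weight (coxWeight n a) m + d = fun i => b i * t i} := by
  ext m; simp [monSet]

lemma finite_monSet {n : ℕ} (a b d : Fin n → ℕ) (s : ℕ) : (monSet a b d s).Finite := by
  rw [monSet_eq]
  exact Set.Finite.biUnion (Finset.finite_toSet _) fun t _ => finite_weight _ _ _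

lemma card_monSet {n : ℕ} (a b d : Fin n → ℕ) (hb : ∀ i, 0 < b i) (s : ℕ) :
    Nat.card (monSet a b d s) =
      ∑ t ∈ Finset.Nat.antidiagonalTuple n s, ∏ i, cnt (a i) (b i) (d i) (t i) := by
  classical
  have h : (finite_monSet a b d s).toFinset = (Finset.Nat.antidiagonalTuple n s).biUnion
      (fun t => (finite_weight a (fun i => b i * t i) d).toFinset) := by
    ext m; simp [monSet]
  rw [Nat.card_coe_set_eq, Set.ncard_eq_toFinset_card _ (finite_monSet a b d s), h,
    Finset.card_biUnion]
  · refine Finset.sum_congr rfl fun t _ => ?_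
    rw [← Set.ncard_eq_toFinset_card _ (finite_weight a (fun i => b i * t i) d), ← Nat.card_coe_set_eq]
    exact card_weight a _ d
  · intro t _ t' _ htt
    rw [Function.onFun, Finset.disjoint_left]
    intro m h1 h2
    simp only [Set.Finite.mem_toFinset, Set.mem_ofPred_eq] at h1 h2
    apply htt
    ext i
    have := congrFun (h1.symm.trans h2) i
    exact Nat.eq_of_mul_eq_mul_left (hb i) this

lemma sup_eq {k : Type} [Field k] {n : ℕ} (a b : Fin n → ℕ) (s : ℕ) :
    (⨆ t ∈ Finset.Nat.antidiagonalTuple n s,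
      weightedHomogeneousSubmodule k (coxWeight n a) (fun i => b i * t i)) =
    restrictSupport k (monSet a b 0 s) := by
  apply le_antisymm
  · refine iSup₂_le fun t ht p hp => ?_
    rw [mem_restrictSupport_iff]
    intro m hm
    refine ⟨t, ht, ?_⟩
    rw [add_zero]
    exact hp (by simpa using hm)
  · rw [restrictSupport_eq_span, Submodule.span_le]
    rintro _ ⟨m, ⟨t, ht, hm⟩, rfl⟩
    refine Submodule.mem_iSup_of_mem t (Submodule.mem_iSup_of_mem ht ?_)
    exact isWeightedHomogeneous_monomial _ _ _ (by simpa using hm)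

lemma comp_mul {k : Type} [Field k] {n : ℕ} (a d e : Fin n → ℕ)
    (f g : MvPolynomial ((i : Fin n) × Fin (a i + 1)) k)
    (hf : f ∈ weightedHomogeneousSubmodule k (coxWeight n a) d) :
    weightedHomogeneousComponent (coxWeight n a) (d + e) (f * g) =
      f * weightedHomogeneousComponent (coxWeight n a) e g := by
  classical
  let _ := weightedGradedAlgebra k (coxWeight n a)
  have := DirectSum.coe_decompose_mul_add_of_left_mem
    (weightedHomogeneousSubmodule k (coxWeight n a)) (i := d) (j := e) (a := f) (b := g) hf
  rw [← weightedDecomposition.decompose'_apply, ← weightedDecomposition.decompose'_apply]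
  exact this

lemma inf_eq {k : Type} [Field k] {n : ℕ} (a b d : Fin n → ℕ) (s : ℕ)
    (f : MvPolynomial ((i : Fin n) × Fin (a i + 1)) k)
    (hf : f ∈ weightedHomogeneousSubmodule k (coxWeight n a) d) (hf0 : f ≠ 0) :
    restrictSupport k (monSet a b 0 s) ⊓ (Ideal.span {f}).restrictScalars k =
      (restrictSupport k (monSet a b d s)).map (LinearMap.mulLeft k f) := by
  classical
  ext p
  simp only [Submodule.mem_inf, Submodule.restrictScalars_mem, Submodule.mem_map,
    LinearMap.mulLeft_apply, Ideal.mem_span_singleton]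
  constructor
  · rintro ⟨hp, g, rfl⟩
    refine ⟨g, ?_, rfl⟩
    rw [mem_restrictSupport_iff] at hp ⊢
    intro m hm
    set e := Finsupp.weight (coxWeight n a) m with he
    have hne : weightedHomogeneousComponent (coxWeight n a) e g ≠ 0 := by
      intro h0
      have := congrArg (coeff m) h0
      rw [coeff_weightedHomogeneousComponent, if_pos he.symm, coeff_zero] at this
      exact (mem_support_iff.1 hm) this
    have h2 := mul_ne_zero hf0 hne
    rw [← comp_mul a d e f g hf] at h2
    obtain ⟨m', hm'⟩ := MvPolynomial.ne_zero_iff.1 h2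
    rw [coeff_weightedHomogeneousComponent] at hm'
    split_ifs at hm' with hw
    · obtain ⟨t, ht, h3⟩ := hp (mem_support_iff.2 hm')
      refine ⟨t, ht, ?_⟩
      rw [← h3, hw, ← he, add_zero, add_comm]
    · exact absurd rfl hm'
  · rintro ⟨g, hg, rfl⟩
    refine ⟨?_, dvd_mul_right _ _⟩
    rw [mem_restrictSupport_iff] at hg ⊢
    intro m hm
    have := support_mul f g hm
    obtain ⟨x, hx, y, hy, rfl⟩ := Finset.mem_add.1 this
    obtain ⟨t, ht, h3⟩ := hg hy
    refine ⟨t, ht, ?_⟩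
    rw [map_add, hf (mem_support_iff.1 hx), add_zero, add_comm, h3]

lemma finrank_restrict {k : Type} [Field k] {n : ℕ} (a b d : Fin n → ℕ) (hb : ∀ i, 0 < b i) (s : ℕ) :
    Module.finrank k (restrictSupport k (monSet a b d s)) =
      ∑ t ∈ Finset.Nat.antidiagonalTuple n s, ∏ i, cnt (a i) (b i) (d i) (t i) := by
  rw [← card_monSet a b d hb, Module.finrank_eq_nat_card_basis (basisRestrictSupport k _)]

lemma hilb_eq {k : Type} [Field k] {n : ℕ} (a b d : Fin n → ℕ) (hb : ∀ i, 0 < b i) (s : ℕ)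
    (f : MvPolynomial ((i : Fin n) × Fin (a i + 1)) k)
    (hf : f ∈ weightedHomogeneousSubmodule k (coxWeight n a) d) (hf0 : f ≠ 0) :
    hilbTb (Ideal.span {f}) b s +
      ∑ t ∈ Finset.Nat.antidiagonalTuple n s, ∏ i, cnt (a i) (b i) (d i) (t i) =
      ∑ t ∈ Finset.Nat.antidiagonalTuple n s, ∏ i, cnt (a i) (b i) 0 (t i) := by
  have h0 := finrank_restrict (k := k) a b 0 hb s
  simp only [Pi.zero_apply] at h0
  rw [← h0, ← finrank_restrict (k := k) a b d hb s]
  set W := restrictSupport k (monSet a b 0 s) with hW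
  set φ := (Ideal.Quotient.mkₐ k (Ideal.span {f})).toLinearMap with hφ
  have hfin : Module.Finite k W := by
    have := (finite_monSet a b 0 s).to_subtype
    exact Module.Finite.of_basis (basisRestrictSupport k _)
  have h1 : hilbTb (Ideal.span {f}) b s = Module.finrank k (W.map φ) := by
    have hs : (⨆ t ∈ Finset.Nat.antidiagonalTuple n s,
        quotComponent (Ideal.span {f}) (fun i => b i * t i)) = W.map φ := by
      rw [hW, ← sup_eq, Submodule.map_iSup]
      refine iSup_congr fun t => ?_
      rw [Submodule.map_iSup]
      rfl
    rw [hilbTb, hs]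
  have hker : LinearMap.ker φ = (Ideal.span {f}).restrictScalars k := by
    ext x
    simp [hφ, Ideal.Quotient.eq_zero_iff_mem]
  have h2 := LinearMap.finrank_range_add_finrank_ker (φ.domRestrict W)
  rw [LinearMap.range_domRestrict] at h2
  have h3 : Module.finrank k (LinearMap.ker (φ.domRestrict W)) =
      Module.finrank k (restrictSupport k (monSet a b d s)) := by
    have hinj : Function.Injective (LinearMap.mulLeft k f) :=
      fun x y h => mul_left_cancel₀ hf0 h
    rw [← LinearEquiv.finrank_eq (Submodule.equivMapOfInjective _ hinj
      (restrictSupport k (monSet a b d s))) |>.symm, ← inf_eq a b d s f hf hf0, ← hker]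
    rw [LinearMap.ker_domRestrict]
    rw [← LinearMap.finrank_range_of_inj (f := W.subtype.domRestrict (Submodule.comap W.subtype (LinearMap.ker φ)))]
    · rw [LinearMap.range_domRestrict, Submodule.map_comap_subtype]
    · intro x y h
      exact Subtype.ext (Subtype.ext h)
  rw [h1, ← h3, h2]

/-!
STATEMENT 10: a divisor `Z` of multidegree `(d₁,…,dₙ)` on `ℙ^{a₁} × ⋯ × ℙ^{aₙ}`
gives a correspondence scroll `C(Z;b)` of degree `∑ᵢ dᵢ bᵢ^{aᵢ−1} ∏_{j≠i} bⱼ^{aⱼ}`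
(and dimension `∑ aᵢ + n − 2`).
-/

theorem degree_correspondence_scroll_of_divisor {k : Type} [Field k] {n : ℕ}
    (hn : 0 < n) (a : Fin n → ℕ) (ha : ∀ i, 0 < a i)
    (b : Fin n → ℕ) (hb : ∀ i, 0 < b i) (d : Fin n → ℕ) (hd : d ≠ 0)
    (f : MvPolynomial ((i : Fin n) × Fin (a i + 1)) k)
    (hf : f ∈ weightedHomogeneousSubmodule k (coxWeight n a) d) (hf0 : f ≠ 0) :
    HasDegreeDim (hilbTb (Ideal.span {f}) b) ((∑ i, a i) + n - 2)
      (∑ i, (d i : ℚ) * (b i : ℚ) ^ (a i - 1) *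
        ∏ j ∈ Finset.univ.erase i, (b j : ℚ) ^ (a j)) := by
  unfold HasDegreeDim
  apply ratSer_hasDegreeDim
  · obtain ⟨i, hi⟩ := Function.ne_iff.1 hd
    have hi : 0 < d i := Nat.pos_of_ne_zero hi
    have hbq : ∀ j, (0 : ℚ) < b j := fun j => by exact_mod_cast hb j
    apply ne_of_gt
    refine Finset.sum_pos' (fun j _ => ?_) ⟨i, Finset.mem_univ i, ?_⟩
    · positivity
    · have h1 : (0 : ℚ) < d i := by exact_mod_cast hi
      exact mul_pos (mul_pos h1 (pow_pos (hbq i) _)) (Finset.prod_pos fun j _ => pow_pos (hbq j) _)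
  · have h := ratSer_main hn a ha b hb d
    convert h using 2 with s
    have := hilb_eq a b d hb s f hf hf0
    rw [eq_sub_iff_add_eq]
    exact_mod_cast this

end
end

section
/- Let Z ⊆ P^1 × P^1 × P^1 (viewed as the affine cone in A^2 × A^2 × A^2) be defined by a regular sequence of two general trilinear forms. Then for b = (b_1,b_2,b_3) ∈ ℕ_+^3, the correspondence scroll C(Z;b) ⊆ P^{b_1+b_2+b_3+2} has degree b_1b_2 + b_1b_3 + b_2b_3 + 2(b_1+b_2+b_3). -/
open MvPolynomial

noncomputable section

abbrev Sg : Type := (i : Fin 3) × Fin ((fun _ : Fin 3 => 1) i + 1)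

abbrev Sd (k : Type) [Field k] (d : Fin 3 → ℕ) : Submodule k (MvPolynomial Sg k) :=
  weightedHomogeneousSubmodule k (coxWeight 3 (fun _ => 1)) d

lemma weight_apply' (m : Sg →₀ ℕ) (i : Fin 3) :
    Finsupp.weight (coxWeight 3 (fun _ => 1)) m i = m ⟨i, 0⟩ + m ⟨i, 1⟩ := by
  rw [Finsupp.weight_apply, Finsupp.sum_fintype _ _ (by simp), Fintype.sum_sigma]
  simp [coxWeight, Fin.sum_univ_three, Fin.sum_univ_two, Pi.single_apply]
  fin_cases i <;> simp

def expEquiv (d : Fin 3 → ℕ) :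
    {m : Sg →₀ ℕ | Finsupp.weight (coxWeight 3 (fun _ => 1)) m = d} ≃ (∀ i, Fin (d i + 1)) where
  toFun m i := ⟨m.1 ⟨i, 0⟩, by
    have := congrFun m.2 i
    rw [weight_apply'] at this
    omega⟩
  invFun t := ⟨Finsupp.equivFunOnFinite.symm
      (fun p : Sg => if p.2 = 0 then (t p.1 : ℕ) else d p.1 - t p.1), by
    funext i
    rw [weight_apply']
    have := (t i).2
    simp
    omega⟩
  left_inv m := by
    apply Subtype.ext
    ext ⟨i, j⟩
    have := congrFun m.2 i
    rw [weight_apply'] at this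
    change Fin 2 at j
    fin_cases j <;> simp
    omega
  right_inv t := by
    funext i
    simp

def sdBasis (k : Type) [Field k] (d : Fin 3 → ℕ) :
    Module.Basis {m : Sg →₀ ℕ | Finsupp.weight (coxWeight 3 (fun _ => 1)) m = d} k (Sd k d) :=
  Module.Basis.ofRepr
    ((LinearEquiv.ofEq _ _ (weightedHomogeneousSubmodule_eq_finsupp_supported k _ d)).trans
      (AddMonoidAlgebra.supportedEquivFinsupp _))

instance sdFinite (k : Type) [Field k] (d : Fin 3 → ℕ) : Module.Finite k (Sd k d) := by
  have : Finite {m : Sg →₀ ℕ | Finsupp.weight (coxWeight 3 (fun _ => 1)) m = d} :=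
    Finite.of_equiv _ (expEquiv d).symm
  exact Module.Finite.of_basis (sdBasis k d)

lemma finrank_Sd (k : Type) [Field k] (d : Fin 3 → ℕ) :
    Module.finrank k (Sd k d) = ∏ i, (d i + 1) := by
  rw [Module.finrank_eq_nat_card_basis (sdBasis k d), Nat.card_congr (expEquiv d)]
  simp

lemma sum_quad (n : ℕ) : ∀ (c0 c1 c2 c3 c4 : ℚ),
    ∑ q ∈ Finset.HasAntidiagonal.antidiagonal n,
      (c0 + c1 * q.1 + c2 * q.2 + c3 * q.1 * q.2 + c4 * (q.2 : ℚ) ^ 2) =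
    (n + 1) * c0 + (c1 + c2) * (n * (n + 1) / 2) + c3 * ((n - 1) * n * (n + 1) / 6)
      + c4 * (n * (n + 1) * (2 * n + 1) / 6) := by
  induction n with
  | zero => intros; simp
  | succ n ih =>
    intro c0 c1 c2 c3 c4
    rw [Finset.Nat.sum_antidiagonal_succ]
    have h := ih (c0 + c1) c1 (c2 + c3) c3 c4
    have e : ∀ q : ℕ × ℕ, (c0 + c1 * ((q.1 + 1 : ℕ) : ℚ) + c2 * q.2 +
        c3 * ((q.1 + 1 : ℕ) : ℚ) * q.2 + c4 * (q.2 : ℚ) ^ 2)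
        = ((c0 + c1) + c1 * q.1 + (c2 + c3) * q.2 + c3 * q.1 * q.2 + c4 * (q.2 : ℚ) ^ 2) := by
      intro q; push_cast; ring
    simp only [e, h]
    push_cast
    ring

lemma sum_delta1 (n : ℕ) (φ : ℕ → ℚ) :
    ∑ q ∈ Finset.HasAntidiagonal.antidiagonal n, (if q.1 = 0 then φ q.2 else 0) = φ n := by
  rw [Finset.sum_eq_single (0, n)]
  · simp
  · rintro ⟨x, y⟩ h h'
    simp only [Finset.HasAntidiagonal.mem_antidiagonal] at h
    rw [if_neg]
    rintro rfl
    simp at h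
    exact h' (by simp [h])
  · simp

lemma sum_delta2 (n : ℕ) (φ : ℕ → ℚ) :
    ∑ q ∈ Finset.HasAntidiagonal.antidiagonal n, (if q.2 = 0 then φ q.1 else 0) = φ n := by
  rw [Finset.sum_eq_single (n, 0)]
  · simp
  · rintro ⟨x, y⟩ h h'
    simp only [Finset.HasAntidiagonal.mem_antidiagonal] at h
    rw [if_neg]
    rintro rfl
    simp at h
    exact h' (by simp [h])
  · simp

lemma sum_tuple (s : ℕ) (F : (Fin 3 → ℕ) → ℚ) :
    ∑ t ∈ Finset.Nat.antidiagonalTuple 3 s, F t =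
      ∑ p ∈ Finset.HasAntidiagonal.antidiagonal s, ∑ q ∈ Finset.HasAntidiagonal.antidiagonal p.2, F ![p.1, q.1, q.2] := by
  rw [Finset.sum_sigma']
  refine Finset.sum_bij' (fun t _ => ⟨(t 0, t 1 + t 2), (t 1, t 2)⟩)
    (fun x _ => ![x.1.1, x.2.1, x.2.2]) ?_ ?_ ?_ ?_ ?_
  · intro t ht
    rw [Finset.Nat.mem_antidiagonalTuple, Fin.sum_univ_three] at ht
    simp; omega
  · rintro ⟨⟨a, b⟩, ⟨c, d⟩⟩ h
    simp at h
    rw [Finset.Nat.mem_antidiagonalTuple, Fin.sum_univ_three]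
    simp; omega
  · intro t ht
    funext i; fin_cases i <;> rfl
  · rintro ⟨⟨a, b⟩, ⟨c, d⟩⟩ h
    simp at h
    simp [h.2]
  · intro t ht
    congr 1
    funext i; fin_cases i <;> rfl

def hfun (d : Fin 3 → ℕ) : ℚ :=
  (∏ i, ((d i : ℚ) + 1)) - 2 * ∏ i, (d i : ℚ) + ∏ i, ((d i - 1 : ℕ) : ℚ)

lemma pred_cast (n : ℕ) : ((n - 1 : ℕ) : ℚ) = (n : ℚ) - 1 + if n = 0 then 1 else 0 := by
  cases n <;> simp

lemma hfun_eq (b : Fin 3 → ℕ) (hb : ∀ i, 0 < b i) (x y z : ℕ) (h : x + y + z ≠ 0) :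
    hfun (fun i => b i * ![x, y, z] i) =
      (0 + 2 * b 1 * y + (2 * b 2) * z + 0 * y * z + 0 * (z:ℚ) ^ 2) + 2 * b 0 * x
      + (if x = 0 then ((b 1 * y - 1) * (b 2 * z - 1) : ℚ) else 0)
      + (if y = 0 then ((b 0 * x - 1) * (b 2 * z - 1) : ℚ) else 0)
      + (if z = 0 then ((b 0 * x - 1) * (b 1 * y - 1) : ℚ) else 0)
      + (if x = 0 then (if y = 0 then (b 2 * z - 1 : ℚ) else 0) else 0)
      + (if x = 0 then (if z = 0 then (b 1 * y - 1 : ℚ) else 0) else 0)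
      + (if y = 0 then (if z = 0 then (b 0 * x - 1 : ℚ) else 0) else 0) := by
  have h0 := (hb 0).ne'
  have h1 := (hb 1).ne'
  have h2 := (hb 2).ne'
  simp only [hfun, pred_cast, Fin.prod_univ_three]
  simp only [Matrix.cons_val_zero, Matrix.cons_val_one, Matrix.cons_val, mul_eq_zero, h0, h1, h2,
    false_or]
  by_cases hx : x = 0 <;> by_cases hy : y = 0 <;> by_cases hz : z = 0 <;>
    simp [hx, hy, hz] <;> first | omega | ring

lemma sum_hfun (b : Fin 3 → ℕ) (hb : ∀ i, 0 < b i) (s : ℕ) (hs : s ≠ 0) :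
    ∑ t ∈ Finset.Nat.antidiagonalTuple 3 s, hfun (fun i => b i * t i) =
      ((b 0 + b 1 + b 2 : ℚ) / 3 + (b 0 * b 1 + b 0 * b 2 + b 1 * b 2) / 6) * (s : ℚ) ^ 3 +
      (2 * (b 0 + b 1 + b 2 : ℚ) / 3 + 3 - (b 0 * b 1 + b 0 * b 2 + b 1 * b 2) / 6) * (s : ℚ) := by
  rw [sum_tuple]
  have pair : ∀ β γ : ℚ, ∑ q ∈ Finset.HasAntidiagonal.antidiagonal s, ((β * q.1 - 1) * (γ * q.2 - 1) : ℚ) =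
      (s + 1) - (β + γ) * (s * (s + 1) / 2) + β * γ * ((s - 1) * s * (s + 1) / 6) := by
    intro β γ
    have := sum_quad s 1 (-β) (-γ) (β * γ) 0
    rw [Finset.sum_congr rfl (g := fun q : ℕ × ℕ => (1 + -β * q.1 + -γ * q.2 + β * γ * q.1 * q.2 + 0 * (q.2 : ℚ) ^ 2)) (fun q _ => by ring), this]
    ring
  rw [Finset.sum_congr rfl (fun p hp => Finset.sum_congr rfl (fun q hq =>
    hfun_eq b hb p.1 q.1 q.2 (by
      rw [Finset.HasAntidiagonal.mem_antidiagonal] at hp hq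
      omega)))]
  have e1 : ∑ p ∈ Finset.HasAntidiagonal.antidiagonal s, ∑ q ∈ Finset.HasAntidiagonal.antidiagonal p.2,
      ((0 + 2 * b 1 * q.1 + (2 * b 2) * q.2 + 0 * q.1 * q.2 + 0 * (q.2:ℚ) ^ 2) + 2 * b 0 * p.1 : ℚ)
      = (b 0 + b 1 + b 2) * (s * (s + 1) * (s + 2) / 3) := by
    simp only [Finset.sum_add_distrib (M := ℚ) (g := fun _ => 2 * (b 0 : ℚ) * _), sum_quad,
      Finset.sum_const, Finset.Nat.card_antidiagonal, nsmul_eq_mul]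
    rw [Finset.sum_congr rfl (g := fun p : ℕ × ℕ => (0 + (2 * b 0 : ℚ) * p.1 + (b 1 + b 2 : ℚ) * p.2 +
      (2 * b 0 : ℚ) * p.1 * p.2 + (b 1 + b 2 : ℚ) * (p.2 : ℚ) ^ 2))
      (fun q _ => by push_cast; ring), sum_quad]
    ring
  have e2 : ∑ p ∈ Finset.HasAntidiagonal.antidiagonal s, ∑ q ∈ Finset.HasAntidiagonal.antidiagonal p.2,
      (if p.1 = 0 then ((b 1 * q.1 - 1) * (b 2 * q.2 - 1) : ℚ) else 0) =
      ∑ q ∈ Finset.HasAntidiagonal.antidiagonal s, ((b 1 * q.1 - 1) * (b 2 * q.2 - 1) : ℚ) := by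
    rw [← sum_delta1 s (fun n => ∑ q ∈ Finset.HasAntidiagonal.antidiagonal n, ((b 1 * q.1 - 1) * (b 2 * q.2 - 1) : ℚ))]
    refine Finset.sum_congr rfl fun p _ => ?_
    split_ifs <;> simp
  have e3 : ∑ p ∈ Finset.HasAntidiagonal.antidiagonal s, ∑ q ∈ Finset.HasAntidiagonal.antidiagonal p.2,
      (if q.1 = 0 then ((b 0 * p.1 - 1) * (b 2 * q.2 - 1) : ℚ) else 0) =
      ∑ q ∈ Finset.HasAntidiagonal.antidiagonal s, ((b 0 * q.1 - 1) * (b 2 * q.2 - 1) : ℚ) :=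
    Finset.sum_congr rfl fun p _ =>
      sum_delta1 p.2 (fun n => ((b 0 * p.1 - 1) * (b 2 * n - 1) : ℚ))
  have e4 : ∑ p ∈ Finset.HasAntidiagonal.antidiagonal s, ∑ q ∈ Finset.HasAntidiagonal.antidiagonal p.2,
      (if q.2 = 0 then ((b 0 * p.1 - 1) * (b 1 * q.1 - 1) : ℚ) else 0) =
      ∑ q ∈ Finset.HasAntidiagonal.antidiagonal s, ((b 0 * q.1 - 1) * (b 1 * q.2 - 1) : ℚ) :=
    Finset.sum_congr rfl fun p _ =>
      sum_delta2 p.2 (fun n => ((b 0 * p.1 - 1) * (b 1 * n - 1) : ℚ))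
  have e5 : ∑ p ∈ Finset.HasAntidiagonal.antidiagonal s, ∑ q ∈ Finset.HasAntidiagonal.antidiagonal p.2,
      (if p.1 = 0 then (if q.1 = 0 then (b 2 * q.2 - 1 : ℚ) else 0) else 0) = b 2 * s - 1 := by
    rw [← sum_delta1 s (fun n => (b 2 * n - 1 : ℚ))]
    refine Finset.sum_congr rfl fun p _ => ?_
    split_ifs
    · exact sum_delta1 p.2 (fun n => (b 2 * n - 1 : ℚ))
    · simp
  have e6 : ∑ p ∈ Finset.HasAntidiagonal.antidiagonal s, ∑ q ∈ Finset.HasAntidiagonal.antidiagonal p.2,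
      (if p.1 = 0 then (if q.2 = 0 then (b 1 * q.1 - 1 : ℚ) else 0) else 0) = b 1 * s - 1 := by
    rw [← sum_delta1 s (fun n => (b 1 * n - 1 : ℚ))]
    refine Finset.sum_congr rfl fun p _ => ?_
    split_ifs
    · exact sum_delta2 p.2 (fun n => (b 1 * n - 1 : ℚ))
    · simp
  have e7 : ∑ p ∈ Finset.HasAntidiagonal.antidiagonal s, ∑ q ∈ Finset.HasAntidiagonal.antidiagonal p.2,
      (if q.1 = 0 then (if q.2 = 0 then (b 0 * p.1 - 1 : ℚ) else 0) else 0) = b 0 * s - 1 := by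
    rw [← sum_delta2 s (fun n => (b 0 * n - 1 : ℚ))]
    exact Finset.sum_congr rfl fun p _ =>
      sum_delta1 p.2 (fun n => if n = 0 then (b 0 * p.1 - 1 : ℚ) else 0)
  simp only [Finset.sum_add_distrib] at e1 ⊢
  rw [e1, e2, e3, e4, e5, e6, e7, pair, pair, pair]
  ring

attribute [local instance] MvPolynomial.weightedGradedAlgebra

abbrev hcmp {k : Type} [Field k] (d : Fin 3 → ℕ) : MvPolynomial Sg k →ₗ[k] MvPolynomial Sg k :=
  weightedHomogeneousComponent (coxWeight 3 (fun _ => 1)) d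

lemma cmp_mem {k : Type} [Field k] (d : Fin 3 → ℕ) (p : MvPolynomial Sg k) : hcmp d p ∈ Sd k d :=
  weightedHomogeneousComponent_mem _ p d

lemma cmp_self {k : Type} [Field k] {d : Fin 3 → ℕ} {p : MvPolynomial Sg k} (h : p ∈ Sd k d) :
    hcmp d p = p :=
  IsWeightedHomogeneous.weightedHomogeneousComponent_same h

lemma cmp_ne {k : Type} [Field k] {d e : Fin 3 → ℕ} {p : MvPolynomial Sg k} (h : p ∈ Sd k d)
    (hne : e ≠ d) : hcmp e p = 0 := by
  rw [hcmp, weightedHomogeneousComponent_of_mem h, if_neg hne]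

open Classical in
lemma cmp_mul {k : Type} [Field k] {e : Fin 3 → ℕ} {p : MvPolynomial Sg k} (h : p ∈ Sd k e)
    (d : Fin 3 → ℕ) (q : MvPolynomial Sg k) :
    hcmp d (p * q) = if e ≤ d then p * hcmp (d - e) q else 0 := by
  have := DirectSum.coe_decompose_mul_of_left_mem (Sd k) (i := e) (b := q) d h
  have key : ∀ (r : MvPolynomial Sg k) (c : Fin 3 → ℕ),
      ((DirectSum.decompose (Sd k) r c : Sd k c) : MvPolynomial Sg k) = hcmp c r := fun r c =>
    weightedDecomposition.decompose'_apply k (coxWeight 3 (fun _ => 1)) r c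
  rw [key, key] at this
  exact this

/-- The degree `d` part of an ideal. -/
abbrev part {k : Type} [Field k] (I : Ideal (MvPolynomial Sg k)) (d : Fin 3 → ℕ) :
    Submodule k (MvPolynomial Sg k) := I.restrictScalars k ⊓ Sd k d

instance partFinite {k : Type} [Field k] (I : Ideal (MvPolynomial Sg k)) (d : Fin 3 → ℕ) :
    Module.Finite k (part I d) := Submodule.finiteDimensional_of_le (S₂ := Sd k d) inf_le_right

lemma finrank_part {k : Type} [Field k] {e : Fin 3 → ℕ} {p : MvPolynomial Sg k} (h : p ∈ Sd k e)
    (hp : p ≠ 0) (d : Fin 3 → ℕ) :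
    Module.finrank k (part (Ideal.span {p}) d) = ∏ i, (d i + 1 - e i) := by
  by_cases hle : e ≤ d
  · have : part (Ideal.span {p}) d = (Sd k (d - e)).map (LinearMap.mulLeft k p) := by
      ext x
      simp only [Submodule.mem_inf, Submodule.restrictScalars_mem, Submodule.mem_map,
        Ideal.mem_span_singleton', LinearMap.mulLeft_apply]
      constructor
      · rintro ⟨⟨a, rfl⟩, hx⟩
        refine ⟨hcmp (d - e) a, cmp_mem _ _, ?_⟩
        have := cmp_mul h d a
        rw [if_pos hle, mul_comm p a, cmp_self hx] at this
        exact this.symm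
      · rintro ⟨y, hy, rfl⟩
        refine ⟨⟨y, mul_comm _ _⟩, ?_⟩
        have := IsWeightedHomogeneous.mul h hy
        rwa [add_tsub_cancel_of_le hle] at this
    have inj : Function.Injective (LinearMap.mulLeft k p) := fun x y hxy => mul_left_cancel₀ hp hxy
    rw [this, ← LinearEquiv.finrank_eq (Submodule.equivMapOfInjective _ inj (Sd k (d - e))),
      finrank_Sd]
    refine Finset.prod_congr rfl fun i _ => ?_
    have : e i ≤ d i := hle i
    simp only [Pi.sub_apply]
    omega
  · have : part (Ideal.span {p}) d = ⊥ := by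
      rw [eq_bot_iff]
      rintro x ⟨hx, hd⟩
      obtain ⟨a, rfl⟩ := Ideal.mem_span_singleton'.1 hx
      have := cmp_mul h d a
      rw [if_neg hle, mul_comm p a, cmp_self hd] at this
      exact this
    rw [this, finrank_bot]
    simp only [Pi.le_def, not_forall, not_le] at hle
    obtain ⟨i, hi⟩ := hle
    exact (Finset.prod_eq_zero (Finset.mem_univ i) (by omega)).symm

lemma cmp_mem_ideal {k : Type} [Field k] {s : Set (MvPolynomial Sg k)} {e : Fin 3 → ℕ}
    (hs : ∀ x ∈ s, x ∈ Sd k e) (d : Fin 3 → ℕ) {p : MvPolynomial Sg k} (hp : p ∈ Ideal.span s) :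
    hcmp d p ∈ Ideal.span s :=
  weightedHomogeneousComponent_mem_of_mem k _
    (Ideal.homogeneous_span _ _ (fun x hx => ⟨e, hs x hx⟩)) hp d

section main

variable {k : Type} [Field k] {f g : MvPolynomial Sg k}

lemma reg_facts (hreg : RingTheory.Sequence.IsRegular (MvPolynomial Sg k) [f, g]) :
    f ≠ 0 ∧ g ≠ 0 ∧ ∀ v, g * v ∈ Ideal.span {f} → v ∈ Ideal.span {f} := by
  have h1 := hreg.top_ne_smul
  have h2 := hreg.regular_mod_prev 0 (by simp)
  have h3 := hreg.regular_mod_prev 1 (by simp)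
  rw [isSMulRegular_iff_right_eq_zero_of_smul] at h2 h3
  have hf : f ≠ 0 := by
    rintro rfl
    have := h2 (Submodule.Quotient.mk 1) (zero_smul _ _)
    rw [Submodule.Quotient.mk_eq_zero] at this
    simp at this
  have h4 : ∀ v, g * v ∈ Ideal.span {f} → v ∈ Ideal.span {f} := by
    intro v hv
    have := h3 (Submodule.Quotient.mk v) (by
      rw [← Submodule.Quotient.mk_smul, Submodule.Quotient.mk_eq_zero]
      simpa using hv)
    rw [Submodule.Quotient.mk_eq_zero] at this
    simpa using this
  refine ⟨hf, ?_, h4⟩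
  rintro rfl
  apply h1
  have := h4 1 (by simp)
  rw [Ideal.eq_top_iff_one _ |>.2 (?_ : (1 : MvPolynomial Sg k) ∈ Ideal.ofList [f, 0])]
  · simp
  · refine Ideal.span_mono ?_ this
    simp

lemma part_eq_sup (hf : f ∈ Sd k 1) (hg : g ∈ Sd k 1) (d : Fin 3 → ℕ) :
    part (Ideal.span {f, g}) d = part (Ideal.span {f}) d ⊔ part (Ideal.span {g}) d := by
  apply le_antisymm
  · rintro x ⟨hx, hd⟩
    obtain ⟨a, c, rfl⟩ := Ideal.mem_span_pair.1 hx
    rw [← cmp_self hd, map_add]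
    refine Submodule.add_mem_sup ⟨?_, cmp_mem _ _⟩ ⟨?_, cmp_mem _ _⟩
    · exact cmp_mem_ideal (e := 1) (by simpa using hf) d
        (Ideal.mul_mem_left _ _ (Ideal.mem_span_singleton_self f))
    · exact cmp_mem_ideal (e := 1) (by simpa using hg) d
        (Ideal.mul_mem_left _ _ (Ideal.mem_span_singleton_self g))
  · refine sup_le (inf_le_inf_right _ ?_) (inf_le_inf_right _ ?_)
    · exact fun x hx => Ideal.span_mono (by simp) hx
    · exact fun x hx => Ideal.span_mono (by simp) hx

lemma part_inf (h : ∀ v, g * v ∈ Ideal.span {f} → v ∈ Ideal.span {f})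
    (d : Fin 3 → ℕ) :
    part (Ideal.span {f}) d ⊓ part (Ideal.span {g}) d = part (Ideal.span {f * g}) d := by
  apply le_antisymm
  · rintro x ⟨⟨hx, hd⟩, ⟨hx', -⟩⟩
    refine ⟨?_, hd⟩
    obtain ⟨v, rfl⟩ := Ideal.mem_span_singleton'.1 hx'
    obtain ⟨w, rfl⟩ := Ideal.mem_span_singleton'.1 (h v (by rw [mul_comm]; exact hx))
    exact Ideal.mem_span_singleton'.2 ⟨w, by ring⟩
  · rintro x ⟨hx, hd⟩
    obtain ⟨w, rfl⟩ := Ideal.mem_span_singleton'.1 hx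
    exact ⟨⟨Ideal.mem_span_singleton'.2 ⟨w * g, by ring⟩, hd⟩,
      ⟨Ideal.mem_span_singleton'.2 ⟨w * f, by ring⟩, hd⟩⟩

lemma finrank_quot (I : Ideal (MvPolynomial Sg k)) (d : Fin 3 → ℕ) :
    Module.finrank k (quotComponent I d) + Module.finrank k (part I d) = ∏ i, (d i + 1) := by
  rw [← finrank_Sd k d]
  have h := LinearMap.finrank_range_add_finrank_ker
    ((Ideal.Quotient.mkₐ k I).toLinearMap.domRestrict (Sd k d))
  rw [← h]
  congr 1
  · rw [LinearMap.range_domRestrict]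
    rfl
  · refine LinearEquiv.finrank_eq ?_
    refine LinearEquiv.symm ?_
    refine (Submodule.equivSubtypeMap _ _).trans (LinearEquiv.ofEq _ _ ?_)
    ext x
    simp [Ideal.Quotient.eq_zero_iff_mem]

instance quotFinite (I : Ideal (MvPolynomial Sg k)) (d : Fin 3 → ℕ) :
    Module.Finite k (quotComponent I d) := by
  unfold quotComponent
  exact Module.Finite.map (Sd k d) _

lemma finrank_quot_fg (hf : f ∈ Sd k 1) (hg : g ∈ Sd k 1)
    (hreg : RingTheory.Sequence.IsRegular (MvPolynomial Sg k) [f, g]) (d : Fin 3 → ℕ) :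
    (Module.finrank k (quotComponent (Ideal.span {f, g}) d) : ℚ) = hfun d := by
  obtain ⟨hf0, hg0, h⟩ := reg_facts hreg
  have h1 := finrank_quot (Ideal.span {f, g}) d
  have h2 := Submodule.finrank_sup_add_finrank_inf_eq
    (part (Ideal.span {f}) d) (part (Ideal.span {g}) d)
  rw [← part_eq_sup hf hg, part_inf h, finrank_part hf hf0, finrank_part hg hg0,
    finrank_part (IsWeightedHomogeneous.mul hf hg) (mul_ne_zero hf0 hg0)] at h2
  simp only [Pi.one_apply, Pi.add_apply, Nat.add_sub_cancel, Nat.reduceAdd,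
    Nat.reduceSubDiff] at h2
  have h1' := congrArg (Nat.cast (R := ℚ)) h1
  have h2' := congrArg (Nat.cast (R := ℚ)) h2
  push_cast at h1' h2'
  unfold hfun
  linarith

lemma finrank_biSup (hf : f ∈ Sd k 1) (hg : g ∈ Sd k 1) {ι : Type} [DecidableEq ι]
    (D : ι → (Fin 3 → ℕ)) (hD : Function.Injective D) (s : Finset ι) :
    Module.finrank k ↥(⨆ t ∈ s, quotComponent (Ideal.span {f, g}) (D t)) =
      ∑ t ∈ s, Module.finrank k (quotComponent (Ideal.span {f, g}) (D t)) := by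
  induction s using Finset.induction_on with
  | empty =>
    rw [Finset.sum_empty, show (⨆ t ∈ (∅ : Finset ι), quotComponent (Ideal.span {f, g}) (D t)) = ⊥ by simp]
    exact finrank_bot _ _
  | insert a s ha ih =>
    rw [Finset.iSup_insert, Finset.sum_insert ha, ← ih]
    have : Module.Finite k ↥(⨆ t ∈ s, quotComponent (Ideal.span {f, g}) (D t)) :=
      by rw [← Finset.sup_eq_iSup]; exact Submodule.finite_finset_sup s _
    rw [← Submodule.finrank_sup_add_finrank_inf_eq]
    set I := Ideal.span {f, g} with hI
    let π : (MvPolynomial Sg k ⧸ I.restrictScalars k) →ₗ[k] (MvPolynomial Sg k ⧸ I.restrictScalars k) :=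
      Submodule.mapQ (I.restrictScalars k) (I.restrictScalars k) (hcmp (D a)) (fun p hp =>
        cmp_mem_ideal (e := 1) (by rintro x (rfl | rfl) <;> assumption) _ hp)
    have hπ : ∀ p, π (Submodule.Quotient.mk p) = Submodule.Quotient.mk (hcmp (D a) p) := fun p => rfl
    have h0 : quotComponent I (D a) ⊓ (⨆ t ∈ s, quotComponent I (D t)) = ⊥ := by
      rw [eq_bot_iff]
      rintro x ⟨hx, hx'⟩
      have e1 : π x = x := by
        obtain ⟨p, hp, rfl⟩ := hx
        exact (hπ p).trans (by rw [cmp_self hp]; rfl)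
      have e2 : (⨆ t ∈ s, quotComponent I (D t)) ≤ LinearMap.ker π := by
        refine iSup₂_le fun t ht => ?_
        rintro _ ⟨p, hp, rfl⟩
        have : D a ≠ D t := fun h => ha (hD h ▸ ht)
        exact (hπ p).trans (by rw [cmp_ne hp this]; rfl)
      have e3 : π x = 0 := e2 hx'
      rw [Submodule.mem_bot, ← e1]
      exact e3
    rw [h0, finrank_bot, add_zero]

end main

theorem degree_CY3_two_trilinear_forms {k : Type} [Field k]
    (b : Fin 3 → ℕ) (hb : ∀ i, 0 < b i)
    (f g : MvPolynomial ((i : Fin 3) × Fin (1 + 1)) k)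
    (hf : f ∈ weightedHomogeneousSubmodule k (coxWeight 3 (fun _ => 1)) (fun _ => 1))
    (hg : g ∈ weightedHomogeneousSubmodule k (coxWeight 3 (fun _ => 1)) (fun _ => 1))
    (hreg : RingTheory.Sequence.IsRegular
      (MvPolynomial ((i : Fin 3) × Fin (1 + 1)) k) [f, g]) :
    HasDegreeDim (hilbTb (Ideal.span {f, g}) b) 3
      ((b 0 : ℚ) * b 1 + (b 0 : ℚ) * b 2 + (b 1 : ℚ) * b 2 +
        2 * ((b 0 : ℚ) + b 1 + b 2)) := by
  have p0 : (0 : ℚ) < b 0 := by exact_mod_cast hb 0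
  have p1 : (0 : ℚ) < b 1 := by exact_mod_cast hb 1
  have p2 : (0 : ℚ) < b 2 := by exact_mod_cast hb 2
  have hlead : ((b 0 + b 1 + b 2 : ℚ) / 3 + (b 0 * b 1 + b 0 * b 2 + b 1 * b 2) / 6) ≠ 0 := by
    positivity
  refine ⟨Polynomial.C ((b 0 + b 1 + b 2 : ℚ) / 3 + (b 0 * b 1 + b 0 * b 2 + b 1 * b 2) / 6)
      * Polynomial.X ^ 3 + Polynomial.C 0 * Polynomial.X ^ 2 +
      Polynomial.C (2 * (b 0 + b 1 + b 2 : ℚ) / 3 + 3 - (b 0 * b 1 + b 0 * b 2 + b 1 * b 2) / 6)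
      * Polynomial.X + Polynomial.C 0, ⟨1, fun s hs => ?_⟩, Polynomial.natDegree_cubic hlead, ?_⟩
  · have hD : Function.Injective (fun (t : Fin 3 → ℕ) (i : Fin 3) => b i * t i) := by
      intro t t' h
      funext i
      exact Nat.eq_of_mul_eq_mul_left (hb i) (congrFun h i)
    have h1 := finrank_biSup (k := k) hf hg _ hD (Finset.Nat.antidiagonalTuple 3 s)
    have h2 : hilbTb (Ideal.span {f, g}) b s = _ := h1
    rw [h2, Nat.cast_sum, Finset.sum_congr rfl (fun t _ => finrank_quot_fg hf hg hreg _),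
      sum_hfun b hb s (by omega)]
    simp
  · rw [Polynomial.leadingCoeff_cubic hlead]
    norm_num [Nat.factorial]
    ring

end
end
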